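/- Let α > 0 be a real number. Then as x → ∞, Σ_{p₃ ≤ x^{1/3}, p₃ prime} p₃^{-α} Σ_{p₂ < p₃, p₂ prime} Σ_{p₁ < p₂, p₁ prime} p₁^{α} = (9/((α+1)(α+2)))·x/(log x)^3 + O(x/(log x)^4). -/

import Mathlib

open Filter Finset

section ZetaGrowth

open Complex

/-- Mean value bound for `x ↦ x ^ z` on an interval of length at most one. -/
lemma norm_cpow_sub_cpow_le {a x : ℝ} (ha : 0 < a) (hax : a ≤ x) (hx : x ≤ a + 1) {z : ℂ}
    (hz : z.re ≤ 1) : ‖(x : ℂ) ^ z - (a : ℂ) ^ z‖ ≤ ‖z‖ * a ^ (z.re - 1) := by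
  have hd : ∀ y ∈ Set.Icc a x, HasDerivWithinAt (fun y : ℝ => (y : ℂ) ^ z)
      (z * (y : ℂ) ^ (z - 1)) (Set.Icc a x) y := by
    intro y hy
    have hy0 : 0 < y := ha.trans_le hy.1
    have h := (hasDerivAt_id (y : ℂ)).cpow_const (c := z) (Or.inl (by simpa using hy0))
    simpa using h.comp_ofReal.hasDerivWithinAt
  have hb : ∀ y ∈ Set.Icc a x, ‖z * (y : ℂ) ^ (z - 1)‖ ≤ ‖z‖ * a ^ (z.re - 1) := by
    intro y hy
    have hy0 : 0 < y := ha.trans_le hy.1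
    rw [norm_mul, norm_cpow_eq_rpow_re_of_pos hy0]
    gcongr ?_ * ?_
    simpa using Real.rpow_le_rpow_of_nonpos ha hy.1 (by linarith : z.re - 1 ≤ 0)
  have h := (convex_Icc a x).norm_image_sub_le_of_norm_hasDerivWithin_le hd hb
    (Set.left_mem_Icc.2 hax) (Set.right_mem_Icc.2 hax)
  refine h.trans (mul_le_of_le_one_right (by positivity) ?_)
  rw [Real.norm_eq_abs, abs_of_nonneg (by linarith)]
  linarith

/-- The `n`-th term of the series for `(s - 1) ζ(s) - 1`. -/
noncomputable def zetaTerm (n : ℕ) (s : ℂ) : ℂ :=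
  (s - 1) * ((n + 1 : ℝ) : ℂ) ^ (-s) + ((n + 2 : ℝ) : ℂ) ^ (1 - s) - ((n + 1 : ℝ) : ℂ) ^ (1 - s)

lemma norm_zetaTerm_le_two_mul (n : ℕ) {s : ℂ} (hs : 0 ≤ s.re) :
    ‖zetaTerm n s‖ ≤ 2 * (‖s - 1‖ * (n + 1 : ℝ) ^ (-s.re)) := by
  have h := norm_cpow_sub_cpow_le (a := n + 1) (x := n + 2) (by positivity) (by linarith)
    (by linarith) (z := 1 - s) (by simpa using hs)
  have h2 : ‖(s - 1) * ((n + 1 : ℝ) : ℂ) ^ (-s)‖ = ‖s - 1‖ * (n + 1 : ℝ) ^ (-s.re) := by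
    rw [norm_mul, norm_cpow_eq_rpow_re_of_pos (by positivity), neg_re]
  rw [norm_sub_rev 1 s, show (1 - s).re - 1 = -s.re by simp] at h
  rw [zetaTerm, add_sub_assoc]
  linarith [norm_add_le ((s - 1) * ((n + 1 : ℝ) : ℂ) ^ (-s))
    (((n + 2 : ℝ) : ℂ) ^ (1 - s) - ((n + 1 : ℝ) : ℂ) ^ (1 - s))]

lemma norm_zetaTerm_le_mul_norm (n : ℕ) {s : ℂ} (hs : 0 ≤ s.re) :
    ‖zetaTerm n s‖ ≤ ‖s - 1‖ * (n + 1 : ℝ) ^ (-s.re) * (‖s‖ / (n + 1)) := by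
  have ha : (0 : ℝ) < n + 1 := by positivity
  set a : ℝ := n + 1 with ha_def
  have hd : ∀ y ∈ Set.Icc a (a + 1), HasDerivWithinAt
      (fun y : ℝ => (y : ℂ) ^ (1 - s) - (1 - s) * (a : ℂ) ^ (-s) * y)
      ((1 - s) * ((y : ℂ) ^ (-s) - (a : ℂ) ^ (-s))) (Set.Icc a (a + 1)) y := by
    intro y hy
    have hy0 : 0 < y := ha.trans_le hy.1
    have h := (hasDerivAt_id (y : ℂ)).cpow_const (c := 1 - s) (Or.inl (by simpa using hy0))
    have h2 := (hasDerivAt_id (y : ℂ)).const_mul ((1 - s) * (a : ℂ) ^ (-s))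
    refine ((h.sub h2).comp_ofReal.congr_deriv ?_).hasDerivWithinAt
    simp only [id_eq, mul_one, show 1 - s - 1 = -s by ring]
    ring
  have hb : ∀ y ∈ Set.Icc a (a + 1), ‖(1 - s) * ((y : ℂ) ^ (-s) - (a : ℂ) ^ (-s))‖ ≤
      ‖s - 1‖ * (‖s‖ * a ^ (-s.re - 1)) := by
    intro y hy
    rw [norm_mul, norm_sub_rev 1 s]
    gcongr
    simpa using norm_cpow_sub_cpow_le ha hy.1 hy.2 (z := -s) (by simp; linarith)
  have h := (convex_Icc a (a + 1)).norm_image_sub_le_of_norm_hasDerivWithin_le hd hb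
    (Set.left_mem_Icc.2 (by linarith)) (Set.right_mem_Icc.2 (by linarith))
  have e1 : zetaTerm n s = ((a + 1 : ℝ) : ℂ) ^ (1 - s) - (1 - s) * (a : ℂ) ^ (-s) * (a + 1 : ℝ)
      - ((a : ℂ) ^ (1 - s) - (1 - s) * (a : ℂ) ^ (-s) * a) := by
    rw [zetaTerm, ← ha_def, show (n + 2 : ℝ) = a + 1 by rw [ha_def]; ring]
    push_cast
    ring
  rw [e1]
  refine h.trans (le_of_eq ?_)
  rw [Real.rpow_sub_one ha.ne', add_sub_cancel_left, norm_one]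
  ring

lemma norm_zetaTerm_le (n : ℕ) {s : ℂ} (hs : 0 ≤ s.re) {θ : ℝ} (hθ : 0 ≤ θ) (hθ1 : θ ≤ 1) :
    ‖zetaTerm n s‖ ≤ 2 * ‖s - 1‖ * ‖s‖ ^ θ * (n + 1 : ℝ) ^ (-(s.re + θ)) := by
  have ha : (0 : ℝ) < n + 1 := by positivity
  have key : ‖zetaTerm n s‖ ≤ ‖s - 1‖ * (n + 1 : ℝ) ^ (-s.re) * (2 * (‖s‖ / (n + 1)) ^ θ) := by
    rcases le_total (‖s‖ / (n + 1)) 1 with h | h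
    · refine (norm_zetaTerm_le_mul_norm n hs).trans ?_
      gcongr
      have h0 : 0 ≤ ‖s‖ / (n + 1) := by positivity
      have := Real.rpow_le_rpow_of_exponent_ge_of_imp h0 h hθ1 (fun _ h1 => by
        by_contra; norm_num at h1)
      rw [Real.rpow_one] at this
      nlinarith [Real.rpow_nonneg h0 θ]
    · refine (norm_zetaTerm_le_two_mul n hs).trans ?_
      have := Real.one_le_rpow h hθ
      rw [mul_comm 2]
      gcongr
      linarith
  refine key.trans (le_of_eq ?_)
  rw [Real.div_rpow (norm_nonneg _) ha.le, neg_add, Real.rpow_add ha, Real.rpow_neg ha.le θ]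
  field_simp

lemma summable_nat_succ_rpow_neg {r : ℝ} (hr : 1 < r) :
    Summable (fun n : ℕ => (n + 1 : ℝ) ^ (-r)) := by
  have h := (summable_nat_add_iff 1).2 (Real.summable_nat_rpow.2 (show -r < -1 by linarith))
  simpa using h

lemma summable_zetaTerm {s : ℂ} (hs : 0 < s.re) : Summable (fun n => zetaTerm n s) := by
  refine Summable.of_norm_bounded
    ((summable_nat_succ_rpow_neg (r := s.re + 1) (by linarith)).mul_left
      (2 * ‖s - 1‖ * ‖s‖ ^ (1 : ℝ))) fun n => ?_
  exact norm_zetaTerm_le n hs.le zero_le_one le_rfl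

lemma tsum_zetaTerm_of_one_lt_re {s : ℂ} (hs : 1 < s.re) :
    1 + ∑' n, zetaTerm n s = riemannZeta₁ s := by
  have hs1 : s ≠ 1 := by rintro rfl; simp at hs
  have hz : riemannZeta₁ s = (s - 1) * riemannZeta s := by
    rw [riemannZeta_eq_inv_sub_mul hs1, mul_inv_cancel_left₀ (sub_ne_zero.2 hs1)]
  have h1 : HasSum (fun n : ℕ => (s - 1) * ((n + 1 : ℝ) : ℂ) ^ (-s)) (riemannZeta₁ s) := by
    rw [hz]
    refine HasSum.mul_left _ ?_
    rw [zeta_eq_tsum_one_div_nat_add_one_cpow hs]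
    have : Summable (fun n : ℕ => 1 / ((n : ℂ) + 1) ^ s) := by
      simpa using (summable_nat_add_iff 1).2 (Complex.summable_one_div_nat_cpow.2 hs)
    have e : (fun n : ℕ => ((n + 1 : ℝ) : ℂ) ^ (-s)) = fun n : ℕ => 1 / ((n : ℂ) + 1) ^ s := by
      funext n
      rw [cpow_neg]
      simp
    rw [e]
    exact this.hasSum
  have h2 : Tendsto (fun N : ℕ => ∑ n ∈ range N, (((n + 2 : ℝ) : ℂ) ^ (1 - s) -
      ((n + 1 : ℝ) : ℂ) ^ (1 - s))) atTop (nhds (0 - 1)) := by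
    have e : ∀ N : ℕ, ∑ n ∈ range N, (((n + 2 : ℝ) : ℂ) ^ (1 - s) -
        ((n + 1 : ℝ) : ℂ) ^ (1 - s)) = ((N + 1 : ℝ) : ℂ) ^ (1 - s) - 1 := by
      intro N
      have := sum_range_sub (fun n : ℕ => ((n + 1 : ℝ) : ℂ) ^ (1 - s)) N
      simp only [Nat.cast_add, Nat.cast_one, Nat.cast_zero, zero_add, ofReal_one, one_cpow] at this
      rw [← this]
      refine sum_congr rfl fun n _ => ?_
      norm_num [add_assoc]
    simp_rw [e]
    refine Tendsto.sub_const ?_ _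
    rw [tendsto_zero_iff_norm_tendsto_zero]
    have e2 : ∀ N : ℕ, ‖((N + 1 : ℝ) : ℂ) ^ (1 - s)‖ = (N + 1 : ℝ) ^ (-(s.re - 1)) := by
      intro N
      rw [norm_cpow_eq_rpow_re_of_pos (by positivity)]
      simp
    simp_rw [e2]
    exact (tendsto_rpow_neg_atTop (by linarith)).comp
      (tendsto_atTop_add_const_right _ _ tendsto_natCast_atTop_atTop)
  have h3 := (summable_zetaTerm (s := s) (by linarith)).hasSum.tendsto_sum_nat
  have h4 := h1.tendsto_sum_nat.add h2
  have h5 := tendsto_nhds_unique h3 (h4.congr fun N => by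
    rw [← sum_add_distrib]
    exact sum_congr rfl fun n _ => by rw [zetaTerm]; ring)
  rw [h5]
  ring

lemma differentiable_zetaTerm (n : ℕ) : Differentiable ℂ (zetaTerm n) := by
  have h1 : ((n + 1 : ℝ) : ℂ) ≠ 0 := by exact_mod_cast (by positivity : (n + 1 : ℝ) ≠ 0)
  have h2 : ((n + 2 : ℝ) : ℂ) ≠ 0 := by exact_mod_cast (by positivity : (n + 2 : ℝ) ≠ 0)
  unfold zetaTerm
  refine ((Differentiable.mul (by fun_prop) ?_).add ?_).sub ?_
  · exact Differentiable.const_cpow (by fun_prop) (Or.inl h1)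
  · exact Differentiable.const_cpow (by fun_prop) (Or.inl h2)
  · exact Differentiable.const_cpow (by fun_prop) (Or.inl h1)

lemma tsum_zetaTerm {s : ℂ} (hs : 0 < s.re) : 1 + ∑' n, zetaTerm n s = riemannZeta₁ s := by
  have hU : IsOpen {z : ℂ | 0 < z.re} := isOpen_lt continuous_const continuous_re
  have hd : DifferentiableOn ℂ (fun z => 1 + ∑' n, zetaTerm n z) {z : ℂ | 0 < z.re} := by
    intro z hz
    have hz : 0 < z.re := hz
    set V : Set ℂ := {w : ℂ | z.re / 2 < w.re} ∩ Metric.ball 0 (‖z‖ + 1)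
    have hV : IsOpen V := (isOpen_lt continuous_const continuous_re).inter Metric.isOpen_ball
    have hzV : z ∈ V := ⟨by simp; linarith, by simp⟩
    have hdV : DifferentiableOn ℂ (fun w => ∑' n, zetaTerm n w) V := by
      refine differentiableOn_tsum_of_summable_norm
        (u := fun n : ℕ => 2 * (‖z‖ + 2) * (‖z‖ + 1) * (n + 1 : ℝ) ^ (-(z.re / 2 + 1)))
        ((summable_nat_succ_rpow_neg (by linarith)).mul_left _)
        (fun n => (differentiable_zetaTerm n).differentiableOn) hV fun n w hw => ?_
      obtain ⟨hw1, hw2⟩ := hw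
      have hw1 : z.re / 2 < w.re := hw1
      have hw2 : ‖w‖ < ‖z‖ + 1 := by simpa using hw2
      have hw3 : ‖w - 1‖ ≤ ‖z‖ + 2 := by
        have := norm_sub_le w 1
        rw [norm_one] at this
        linarith
      refine (norm_zetaTerm_le n (by linarith) zero_le_one le_rfl).trans ?_
      rw [Real.rpow_one]
      gcongr
      linarith
    exact ((hdV.differentiableAt (hV.mem_nhds hzV)).const_add 1).differentiableWithinAt
  have h := (hd.analyticOnNhd hU).eqOn_of_preconnected_of_eventuallyEq
    (differentiable_riemannZeta₁.differentiableOn.analyticOnNhd hU)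
    (convex_halfSpace_re_gt 0).isPreconnected (z₀ := 2) (by simp) ?_
  · exact h hs
  · filter_upwards [(isOpen_lt continuous_const continuous_re).mem_nhds
      (show (2 : ℂ) ∈ {z : ℂ | 1 < z.re} by simp)] with w hw
    exact tsum_zetaTerm_of_one_lt_re hw

/-- Near the line `Re s = 1`, the function `(s - 1) ζ(s)` grows like `|t| ^ (1 + θ)` at most. -/
lemma exists_norm_riemannZeta₁_le {θ : ℝ} (hθ : 0 < θ) (hθ1 : θ ≤ 1) :
    ∃ C > 0, ∀ s : ℂ, 1 - θ / 2 ≤ s.re → s.re ≤ 4 →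
      ‖riemannZeta₁ s‖ ≤ C * (1 + |s.im|) ^ (1 + θ) := by
  set S := ∑' n : ℕ, (n + 1 : ℝ) ^ (-(1 + θ / 2))
  have hsum : Summable (fun n : ℕ => (n + 1 : ℝ) ^ (-(1 + θ / 2))) :=
    summable_nat_succ_rpow_neg (by linarith)
  have hS : 0 ≤ S := tsum_nonneg fun n => by positivity
  refine ⟨1 + 2 * 4 * 4 ^ θ * S, by positivity, fun s h1 h2 => ?_⟩
  set T := 1 + |s.im| with hT
  have hT1 : 1 ≤ T := by rw [hT]; linarith [abs_nonneg s.im]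
  have hs : ‖s‖ ≤ 4 * T := by
    refine (norm_le_abs_re_add_abs_im s).trans ?_
    rw [abs_of_nonneg (by linarith)]
    rw [hT]
    linarith [abs_nonneg s.im]
  have hs1 : ‖s - 1‖ ≤ 4 * T := by
    refine (norm_le_abs_re_add_abs_im _).trans ?_
    simp only [sub_re, one_re, sub_im, one_im, sub_zero]
    have : |s.re - 1| ≤ 3 := abs_le.2 ⟨by linarith, by linarith⟩
    rw [hT]
    linarith [abs_nonneg s.im]
  have hb : ∀ n : ℕ, ‖zetaTerm n s‖ ≤
      2 * (4 * T) * (4 * T) ^ θ * (n + 1 : ℝ) ^ (-(1 + θ / 2)) := by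
    intro n
    refine (norm_zetaTerm_le n (by linarith) hθ.le hθ1).trans ?_
    have : (n + 1 : ℝ) ^ (-(s.re + θ)) ≤ (n + 1 : ℝ) ^ (-(1 + θ / 2)) :=
      Real.rpow_le_rpow_of_exponent_le (by linarith [n.cast_nonneg (α := ℝ)]) (by linarith)
    gcongr
  rw [← tsum_zetaTerm (by linarith)]
  have h3 : ‖∑' n, zetaTerm n s‖ ≤ 2 * (4 * T) * (4 * T) ^ θ * S := by
    refine (tsum_of_norm_bounded (hsum.mul_left _).hasSum hb).trans (le_of_eq ?_)
    rw [tsum_mul_left]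
  refine (norm_add_le _ _).trans ?_
  have h4 : (1 : ℝ) ≤ T ^ (1 + θ) := Real.one_le_rpow hT1 (by linarith)
  have h5 : 2 * (4 * T) * (4 * T) ^ θ * S = 2 * 4 * 4 ^ θ * S * T ^ (1 + θ) := by
    rw [Real.mul_rpow (by norm_num) (by linarith), Real.rpow_add (by linarith), Real.rpow_one]
    ring
  rw [norm_one, add_mul, one_mul]
  linarith

lemma exists_norm_deriv_riemannZeta₁_le {θ : ℝ} (hθ : 0 < θ) (hθ1 : θ ≤ 1) :
    ∃ C > 0, ∀ s : ℂ, 1 - θ / 4 ≤ s.re → s.re ≤ 3 →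
      ‖deriv riemannZeta₁ s‖ ≤ C * (1 + |s.im|) ^ (1 + θ) := by
  obtain ⟨C, hC, h⟩ := exists_norm_riemannZeta₁_le hθ hθ1
  refine ⟨C * 2 ^ (1 + θ) / (θ / 4), by positivity, fun s h1 h2 => ?_⟩
  refine (norm_deriv_le_of_forall_mem_sphere_norm_le (R := θ / 4)
    (C := C * 2 ^ (1 + θ) * (1 + |s.im|) ^ (1 + θ)) (by positivity)
    differentiable_riemannZeta₁.diffContOnCl fun z hz => ?_).trans (le_of_eq (by ring))
  have hz : ‖z - s‖ = θ / 4 := by simpa using hz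
  have hre := abs_le.1 ((abs_re_le_norm (z - s)).trans hz.le)
  have him := abs_le.1 ((abs_im_le_norm (z - s)).trans hz.le)
  simp only [sub_re, sub_im] at hre him
  refine (h z (by linarith) (by linarith)).trans ?_
  rw [mul_assoc, ← Real.mul_rpow (by norm_num) (by positivity)]
  gcongr
  have : |z.im| ≤ |s.im| + θ / 4 :=
    abs_le.2 ⟨by linarith [neg_abs_le s.im], by linarith [le_abs_self s.im]⟩
  linarith [abs_nonneg s.im]

lemma riemannZeta₁_ne_zero_of_one_le_re {s : ℂ} (hs : 1 ≤ s.re) : riemannZeta₁ s ≠ 0 := by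
  by_cases h : s = 1
  · simp [h]
  · intro h0
    refine riemannZeta_ne_zero_of_one_le_re hs ?_
    rw [riemannZeta_eq_inv_sub_mul h, h0, mul_zero]

lemma exists_le_norm_riemannZeta₁_pow_four {θ : ℝ} (hθ : 0 < θ) (hθ1 : θ ≤ 1) :
    ∃ c > 0, ∀ s : ℂ, 1 < s.re → s.re ≤ 2 → 1 ≤ |s.im| →
      c * (s.re - 1) ^ 3 * (1 + |s.im|) ^ (4 - θ) ≤ ‖riemannZeta₁ s‖ ^ 4 := by
  obtain ⟨C, hC, hZ⟩ := exists_norm_riemannZeta₁_le hθ hθ1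
  refine ⟨1 / (128 * C ^ 4), by positivity, fun s h1 h2 ht => ?_⟩
  set T := 1 + |s.im| with hT
  have hT1 : 1 ≤ T := by rw [hT]; linarith
  have hx : 0 < s.re - 1 := by linarith
  have h341 := DirichletCharacter.norm_LFunction_product_ge_one (1 : DirichletCharacter ℂ 1)
    hx s.im
  rw [DirichletCharacter.LFunctionTrivChar, DirichletCharacter.LFunction_modOne_eq,
    DirichletCharacter.LFunction_modOne_eq] at h341
  set s1 : ℂ := 1 + ((s.re - 1 : ℝ) : ℂ) with hs1
  have es : 1 + ((s.re - 1 : ℝ) : ℂ) + I * s.im = s := by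
    apply Complex.ext <;> simp
  set s2 : ℂ := s1 + 2 * I * s.im with hs2
  rw [es] at h341
  have e1re : s1.re = s.re := by simp [hs1]
  have e1im : s1.im = 0 := by simp [hs1]
  have e2re : s2.re = s.re := by simp [hs2, e1re]
  have e2im : s2.im = 2 * s.im := by simp [hs2, e1im]
  have n1 : s1 ≠ 1 := fun h => by rw [h] at e1re; simp at e1re; linarith
  have n0 : s ≠ 1 := fun h => by rw [h] at h1; simp at h1
  have n2 : s2 ≠ 1 := fun h => by rw [h] at e2re; simp at e2re; linarith
  rw [riemannZeta_eq_inv_sub_mul n1, riemannZeta_eq_inv_sub_mul n0,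
    riemannZeta_eq_inv_sub_mul n2] at h341
  simp only [norm_mul, norm_pow, norm_inv] at h341
  have d1 : ‖s1 - 1‖ = s.re - 1 := by
    rw [hs1, add_sub_cancel_left, norm_real, Real.norm_eq_abs, abs_of_pos hx]
  have d0 : T / 2 ≤ ‖s - 1‖ := by
    refine le_trans ?_ (abs_im_le_norm _)
    simp only [sub_im, one_im, sub_zero]
    rw [hT]; linarith
  have d2 : T / 2 ≤ ‖s2 - 1‖ := by
    refine le_trans ?_ (abs_im_le_norm _)
    simp only [sub_im, one_im, sub_zero, e2im, abs_mul, abs_two]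
    rw [hT]; linarith
  have u1 : ‖riemannZeta₁ s1‖ ≤ C := by
    have := hZ s1 (by linarith) (by linarith)
    simpa [e1im] using this
  have u2 : ‖riemannZeta₁ s2‖ ≤ 4 * C * T ^ (1 + θ) := by
    refine (hZ s2 (by linarith) (by linarith)).trans ?_
    have h4 : (1 + |s2.im|) ^ (1 + θ) ≤ (2 * T) ^ (1 + θ) := by
      gcongr
      rw [e2im, abs_mul, abs_two, hT]; linarith
    have h5 : (2 : ℝ) ^ (1 + θ) ≤ 4 := by
      have := Real.rpow_le_rpow_of_exponent_le (one_le_two) (show 1 + θ ≤ 2 by linarith)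
      norm_num at this
      exact this
    rw [Real.mul_rpow (by norm_num) (by linarith)] at h4
    have h6 : 0 ≤ T ^ (1 + θ) := by positivity
    calc C * (1 + |s2.im|) ^ (1 + θ) ≤ C * (2 ^ (1 + θ) * T ^ (1 + θ)) := by gcongr
      _ ≤ C * (4 * T ^ (1 + θ)) := by gcongr
      _ = 4 * C * T ^ (1 + θ) := by ring
  have hp0 : 0 < ‖s - 1‖ := lt_of_lt_of_le (by positivity) d0
  have hp2 : 0 < ‖s2 - 1‖ := lt_of_lt_of_le (by positivity) d2
  rw [d1] at h341
  have h7 : (s.re - 1) ^ 3 * ‖s - 1‖ ^ 4 * ‖s2 - 1‖ ≤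
      ‖riemannZeta₁ s1‖ ^ 3 * ‖riemannZeta₁ s‖ ^ 4 * ‖riemannZeta₁ s2‖ := by
    have h8 : ((s.re - 1)⁻¹ * ‖riemannZeta₁ s1‖) ^ 3 * (‖s - 1‖⁻¹ * ‖riemannZeta₁ s‖) ^ 4 *
        (‖s2 - 1‖⁻¹ * ‖riemannZeta₁ s2‖) =
        (‖riemannZeta₁ s1‖ ^ 3 * ‖riemannZeta₁ s‖ ^ 4 * ‖riemannZeta₁ s2‖) /
        ((s.re - 1) ^ 3 * ‖s - 1‖ ^ 4 * ‖s2 - 1‖) := by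
      field_simp
    rw [h8, ge_iff_le, one_le_div (by positivity)] at h341
    exact h341
  have h9 : (s.re - 1) ^ 3 * (T / 2) ^ 4 * (T / 2) ≤
      C ^ 3 * ‖riemannZeta₁ s‖ ^ 4 * (4 * C * T ^ (1 + θ)) :=
    (by gcongr : _ ≤ (s.re - 1) ^ 3 * ‖s - 1‖ ^ 4 * ‖s2 - 1‖).trans
      (h7.trans (by gcongr))
  have e5 : T ^ (5 : ℕ) = T ^ (4 - θ) * T ^ (1 + θ) := by
    rw [← Real.rpow_add (by linarith), ← Real.rpow_natCast]
    congr 1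
    push_cast
    ring
  have hTp : 0 < T ^ (1 + θ) := by positivity
  have h10 : (s.re - 1) ^ 3 * T ^ (4 - θ) * T ^ (1 + θ) ≤
      (128 * C ^ 4 * ‖riemannZeta₁ s‖ ^ 4) * T ^ (1 + θ) := by
    rw [mul_assoc, ← e5]
    nlinarith
  have h11 := le_of_mul_le_mul_right h10 hTp
  rw [mul_assoc, one_div, inv_mul_le_iff₀ (by positivity)]
  exact h11

/-- Quantitative non-vanishing of `(s - 1) ζ(s)` on the right of the line `Re s = 1`. -/
lemma exists_le_norm_riemannZeta₁ {θ : ℝ} (hθ : 0 < θ) (hθ1 : 4 * θ ≤ 1) :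
    ∃ c > 0, ∀ s : ℂ, 1 < s.re → s.re ≤ 2 →
      c * (1 + |s.im|) ^ (1 - 4 * θ) ≤ ‖riemannZeta₁ s‖ := by
  obtain ⟨c₁, hc₁, h4⟩ := exists_le_norm_riemannZeta₁_pow_four hθ (by linarith)
  obtain ⟨C, hC, hd⟩ := exists_norm_deriv_riemannZeta₁_le hθ (by linarith)
  obtain ⟨m, hm, hsmall⟩ : ∃ m > 0, ∀ s : ℂ, 1 < s.re → s.re ≤ 2 → |s.im| ≤ 1 →
      m ≤ ‖riemannZeta₁ s‖ := by
    obtain ⟨z, hz, hmin⟩ := (isCompact_Icc.reProdIm isCompact_Icc :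
        IsCompact (Set.Icc (1 : ℝ) 2 ×ℂ Set.Icc (-1 : ℝ) 1)).exists_isMinOn
      ⟨1, by simp [mem_reProdIm]⟩
      (differentiable_riemannZeta₁.continuous.norm.continuousOn)
    refine ⟨‖riemannZeta₁ z‖, norm_pos_iff.2 (riemannZeta₁_ne_zero_of_one_le_re ?_),
      fun s h1 h2 h3 => hmin ?_⟩
    · exact (mem_reProdIm.1 hz).1.1
    · exact mem_reProdIm.2 ⟨⟨h1.le, h2⟩, abs_le.1 h3⟩
  set c₂ := c₁ ^ ((1 : ℝ) / 4) with hc₂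
  have hc₂0 : 0 < c₂ := by positivity
  have hc₂4 : c₂ ^ 4 = c₁ := by
    rw [hc₂, ← Real.rpow_natCast, ← Real.rpow_mul hc₁.le]
    norm_num
  set b := min 1 (c₂ / (2 * C)) with hb
  have hb0 : 0 < b := by positivity
  have hb1 : b ≤ 1 := min_le_left _ _
  have hbC : 2 * C * b ≤ c₂ := by
    have : b ≤ c₂ / (2 * C) := min_le_right _ _
    rw [le_div_iff₀ (by positivity)] at this
    linarith
  have far : ∀ s : ℂ, s.re ≤ 2 → 1 ≤ |s.im| →
      1 + b ^ 4 * (1 + |s.im|) ^ (-5 * θ) ≤ s.re →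
      c₂ * b ^ 3 * (1 + |s.im|) ^ (1 - 4 * θ) ≤ ‖riemannZeta₁ s‖ := by
    intro s h2 ht hσ
    set T := 1 + |s.im| with hT
    have hT0 : 0 < T := by positivity
    have hlt : 0 < b ^ 4 * T ^ (-5 * θ) := by positivity
    refine le_of_pow_le_pow_left₀ (n := 4) (by norm_num) (norm_nonneg _) ?_
    refine le_trans ?_ (h4 s (by linarith) h2 ht)
    have e : (c₂ * b ^ 3 * T ^ (1 - 4 * θ)) ^ 4 =
        c₁ * (b ^ 4 * T ^ (-5 * θ)) ^ 3 * T ^ (4 - θ) := by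
      have e1 : (T ^ (1 - 4 * θ)) ^ 4 = (T ^ (-5 * θ)) ^ 3 * T ^ (4 - θ) := by
        rw [← Real.rpow_mul_natCast hT0.le, ← Real.rpow_mul_natCast hT0.le,
          ← Real.rpow_add hT0]
        congr 1
        push_cast
        ring
      rw [mul_pow, mul_pow, e1, hc₂4]
      ring
    rw [e]
    gcongr
    linarith
  refine ⟨min (m / 2) (c₂ * b ^ 3 / 2), by positivity, fun s h1 h2 => ?_⟩
  set T := 1 + |s.im| with hT
  have hT1 : 1 ≤ T := by rw [hT]; linarith [abs_nonneg s.im]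
  have hT0 : 0 < T := by linarith
  rcases le_total |s.im| 1 with ht | ht
  · refine le_trans ?_ (hsmall s h1 h2 ht)
    have h5 : T ^ (1 - 4 * θ) ≤ 2 := by
      have h6 := Real.rpow_le_rpow_of_exponent_le hT1 (show 1 - 4 * θ ≤ 1 by linarith)
      rw [Real.rpow_one] at h6
      linarith
    calc _ ≤ m / 2 * 2 := by gcongr; exact min_le_left _ _
      _ = m := by ring
  · have hmin : min (m / 2) (c₂ * b ^ 3 / 2) * T ^ (1 - 4 * θ) ≤
        c₂ * b ^ 3 / 2 * T ^ (1 - 4 * θ) := by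
      gcongr; exact min_le_right _ _
    refine hmin.trans ?_
    have hTp : 0 < T ^ (1 - 4 * θ) := by positivity
    set r := b ^ 4 * T ^ (-5 * θ) with hr
    have hr0 : 0 < r := by positivity
    have hr1 : r ≤ 1 := by
      refine mul_le_one₀ (pow_le_one₀ hb0.le hb1) (by positivity) ?_
      exact Real.rpow_le_one_of_one_le_of_nonpos hT1 (by linarith)
    rcases le_total (1 + r) s.re with hσ | hσ
    · have := far s h2 ht hσ
      have : 0 < c₂ * b ^ 3 * T ^ (1 - 4 * θ) := by positivity
      linarith
    · set z : ℂ := ⟨1 + r, s.im⟩ with hz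
      have hfar : c₂ * b ^ 3 * T ^ (1 - 4 * θ) ≤ ‖riemannZeta₁ z‖ :=
        far z (by simp [hz]; linarith) ht le_rfl
      have hseg : ∀ w ∈ segment ℝ s z, ‖deriv riemannZeta₁ w‖ ≤ C * T ^ (1 + θ) := by
        intro w hw
        obtain ⟨p, q, hp, hq, hpq, rfl⟩ := hw
        have hre : (p • s + q • z).re = p * s.re + q * (1 + r) := by simp [hz]
        have him : (p • s + q • z).im = s.im := by
          simp only [add_im, real_smul, mul_im, ofReal_re, ofReal_im, hz]
          linear_combination s.im * hpq
        have := hd (p • s + q • z) (by rw [hre]; nlinarith) (by rw [hre]; nlinarith)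
        rwa [him] at this
      have hlip := (convex_segment s z).norm_image_sub_le_of_norm_deriv_le
        (fun w _ => differentiable_riemannZeta₁ w) hseg (left_mem_segment ℝ s z)
        (right_mem_segment ℝ s z)
      have hzs : ‖z - s‖ ≤ r := by
        have : z - s = ((1 + r - s.re : ℝ) : ℂ) := by apply Complex.ext <;> simp [hz]
        rw [this, norm_real, Real.norm_eq_abs, abs_of_nonneg (by linarith)]
        linarith
      have h6 : C * T ^ (1 + θ) * ‖z - s‖ ≤ c₂ * b ^ 3 / 2 * T ^ (1 - 4 * θ) := by
        calc C * T ^ (1 + θ) * ‖z - s‖ ≤ C * T ^ (1 + θ) * r := by gcongr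
          _ = C * b * (b ^ 3 * T ^ (1 - 4 * θ)) := by
            have e : T ^ (1 - 4 * θ) = T ^ (1 + θ) * T ^ (-5 * θ) := by
              rw [← Real.rpow_add hT0]
              ring_nf
            rw [hr, e]
            ring
          _ ≤ c₂ / 2 * (b ^ 3 * T ^ (1 - 4 * θ)) := by gcongr; linarith
          _ = _ := by ring
      have h7 := norm_sub_norm_le (riemannZeta₁ z) (riemannZeta₁ s)
      linarith

/-- The Laplace transform of `u ↦ ψ(e ^ u) / e ^ u - 1`, in terms of the zeta function. -/
noncomputable def psiLaplace (s : ℂ) : ℂ :=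
  -(1 + deriv riemannZeta₁ s / riemannZeta₁ s) / s

lemma differentiableAt_psiLaplace {s : ℂ} (hs : s ≠ 0) (hZ : riemannZeta₁ s ≠ 0) :
    DifferentiableAt ℂ psiLaplace s := by
  have h1 : DifferentiableAt ℂ (deriv riemannZeta₁) s :=
    (differentiable_riemannZeta₁.analyticAt s).deriv.differentiableAt
  have h2 : DifferentiableAt ℂ riemannZeta₁ s := differentiable_riemannZeta₁ s
  exact (((h1.div h2 hZ).const_add 1).neg).div differentiableAt_id hs

lemma exists_norm_iteratedDeriv_psiLaplace_le {θ : ℝ} (hθ : 0 < θ) (hθ1 : 4 * θ ≤ 1) :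
    ∃ C > 0, ∀ s : ℂ, 1 < s.re → s.re ≤ 2 →
      ‖iteratedDeriv 2 psiLaplace s‖ ≤ C * (1 + |s.im|) ^ (15 * θ - 1) := by
  obtain ⟨c, hc, hlow⟩ := exists_le_norm_riemannZeta₁ hθ hθ1
  obtain ⟨C, hC, hd⟩ := exists_norm_deriv_riemannZeta₁_le hθ (by linarith)
  set a := min (θ / 4) (c / (8 * C)) with ha
  have ha0 : 0 < a := by positivity
  have haθ : a ≤ θ / 4 := min_le_left _ _
  have haC : 8 * C * a ≤ c := by
    have : a ≤ c / (8 * C) := min_le_right _ _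
    rw [le_div_iff₀ (by positivity)] at this
    linarith
  refine ⟨2 * (4 * (1 + 8 * C / c)) / a ^ 2, by positivity, fun s h1 h2 => ?_⟩
  set T := 1 + |s.im| with hT
  have hT1 : 1 ≤ T := by rw [hT]; linarith [abs_nonneg s.im]
  have hT0 : 0 < T := by linarith
  set r := a * T ^ (-5 * θ) with hr
  have hr0 : 0 < r := by positivity
  have hra : r ≤ a := mul_le_of_le_one_right ha0.le
    (Real.rpow_le_one_of_one_le_of_nonpos hT1 (by linarith))
  have hball : ∀ z ∈ Metric.closedBall s r, s.re - θ / 4 ≤ z.re ∧ z.re ≤ 3 ∧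
      |s.im| - 1 / 4 ≤ |z.im| ∧ ‖deriv riemannZeta₁ z‖ ≤ 4 * C * T ^ (1 + θ) := by
    intro z hz
    have hz : ‖z - s‖ ≤ r := by simpa [dist_eq_norm] using hz
    have hre := abs_le.1 ((abs_re_le_norm (z - s)).trans hz)
    have him := (abs_im_le_norm (z - s)).trans hz
    simp only [sub_re, sub_im] at hre him
    have him2 := abs_sub_abs_le_abs_sub s.im z.im
    have him3 := abs_sub_abs_le_abs_sub z.im s.im
    rw [abs_sub_comm] at him2
    refine ⟨by linarith, by linarith, by linarith, ?_⟩
    refine (hd z (by linarith) (by linarith)).trans ?_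
    have h4 : (1 + |z.im|) ^ (1 + θ) ≤ (2 * T) ^ (1 + θ) := by
      gcongr
      rw [hT]; linarith [abs_nonneg s.im]
    have h5 : (2 : ℝ) ^ (1 + θ) ≤ 4 := by
      have := Real.rpow_le_rpow_of_exponent_le (one_le_two) (show 1 + θ ≤ 2 by linarith)
      norm_num at this
      exact this
    rw [Real.mul_rpow (by norm_num) hT0.le] at h4
    calc C * (1 + |z.im|) ^ (1 + θ) ≤ C * (2 ^ (1 + θ) * T ^ (1 + θ)) := by gcongr
      _ ≤ C * (4 * T ^ (1 + θ)) := by gcongr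
      _ = 4 * C * T ^ (1 + θ) := by ring
  have hZ : ∀ z ∈ Metric.closedBall s r, c / 2 * T ^ (1 - 4 * θ) ≤ ‖riemannZeta₁ z‖ := by
    intro z hz
    have hlip := (convex_closedBall s r).norm_image_sub_le_of_norm_deriv_le
      (fun w _ => differentiable_riemannZeta₁ w) (fun w hw => (hball w hw).2.2.2) hz
      (Metric.mem_closedBall_self hr0.le)
    have hz : ‖s - z‖ ≤ r := by simpa [dist_eq_norm, norm_sub_rev] using hz
    have h6 : 4 * C * T ^ (1 + θ) * ‖s - z‖ ≤ c / 2 * T ^ (1 - 4 * θ) := by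
      have e : T ^ (1 - 4 * θ) = T ^ (1 + θ) * T ^ (-5 * θ) := by
        rw [← Real.rpow_add hT0]
        ring_nf
      calc 4 * C * T ^ (1 + θ) * ‖s - z‖ ≤ 4 * C * T ^ (1 + θ) * r := by gcongr
        _ = 4 * C * a * T ^ (1 - 4 * θ) := by rw [hr, e]; ring
        _ ≤ c / 2 * T ^ (1 - 4 * θ) := by gcongr; linarith
    have h7 := norm_sub_norm_le (riemannZeta₁ s) (riemannZeta₁ z)
    have h8 := hlow s h1 h2
    linarith
  have hz4 : ∀ z ∈ Metric.closedBall s r, T / 4 ≤ ‖z‖ := by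
    intro z hz
    obtain ⟨b1, -, b3, -⟩ := hball z hz
    have := (le_abs_self _).trans (abs_re_le_norm z)
    have := abs_im_le_norm z
    rw [hT]
    linarith
  have hdiff : DifferentiableOn ℂ psiLaplace (Metric.closedBall s r) := by
    intro z hz
    refine (differentiableAt_psiLaplace ?_ ?_).differentiableWithinAt
    · exact norm_pos_iff.1 (lt_of_lt_of_le (by positivity) (hz4 z hz))
    · exact norm_pos_iff.1 (lt_of_lt_of_le (by positivity) (hZ z hz))
  have hbound : ∀ z ∈ Metric.sphere s r,
      ‖psiLaplace z‖ ≤ 4 * (1 + 8 * C / c) * T ^ (5 * θ - 1) := by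
    intro z hz
    have hz := Metric.sphere_subset_closedBall hz
    rw [psiLaplace, norm_div, norm_neg]
    have e : T ^ (1 + θ) = T ^ (5 * θ) * T ^ (1 - 4 * θ) := by
      rw [← Real.rpow_add hT0]
      ring_nf
    have hTp : 0 < T ^ (1 - 4 * θ) := by positivity
    have hTq : 1 ≤ T ^ (5 * θ) := Real.one_le_rpow hT1 (by linarith)
    have h9 : ‖1 + deriv riemannZeta₁ z / riemannZeta₁ z‖ ≤ (1 + 8 * C / c) * T ^ (5 * θ) := by
      calc ‖1 + deriv riemannZeta₁ z / riemannZeta₁ z‖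
          ≤ 1 + ‖deriv riemannZeta₁ z‖ / ‖riemannZeta₁ z‖ := by
            simpa [norm_div] using norm_add_le 1 (deriv riemannZeta₁ z / riemannZeta₁ z)
        _ ≤ 1 + 4 * C * T ^ (1 + θ) / (c / 2 * T ^ (1 - 4 * θ)) := by
            gcongr
            · exact (hball z hz).2.2.2
            · exact hZ z hz
        _ = 1 + 8 * C / c * T ^ (5 * θ) := by
            rw [e]
            field_simp
            ring
        _ ≤ (1 + 8 * C / c) * T ^ (5 * θ) := by linarith
    calc _ ≤ (1 + 8 * C / c) * T ^ (5 * θ) / (T / 4) := by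
          gcongr
          exact hz4 z hz
      _ = _ := by
          rw [Real.rpow_sub_one hT0.ne']
          field_simp
  have hcauchy := norm_iteratedDeriv_le_of_forall_mem_sphere_norm_le 2 hr0
    (hdiff.diffContOnCl_ball subset_rfl) hbound
  refine hcauchy.trans (le_of_eq ?_)
  have e : T ^ (15 * θ - 1) = T ^ (5 * θ - 1) / (T ^ (-5 * θ)) ^ 2 := by
    rw [← Real.rpow_mul_natCast hT0.le, ← Real.rpow_sub hT0]
    congr 1
    push_cast
    ring
  rw [e, hr, Nat.factorial_two]
  push_cast
  field_simp

end ZetaGrowth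

section PsiFourier

open MeasureTheory ArithmeticFunction
open scoped FourierTransform

/-- The relative error in the prime number theorem, in logarithmic scale. -/
noncomputable def psiErr (u : ℝ) : ℝ := Chebyshev.psi (Real.exp u) / Real.exp u - 1

/-- The relative error `psiErr`, cut off to positive arguments and damped by `exp (-ε * u)`. -/
noncomputable def psiErrDamped (ε u : ℝ) : ℂ :=
  (if 0 < u then Real.exp (-ε * u) * psiErr u else 0 : ℝ)

theorem sum_vonMangoldt_eq_psi (t : ℝ) :
    ∑ k ∈ Icc 1 ⌊t⌋₊, vonMangoldt k = Chebyshev.psi t := by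
  rw [Chebyshev.psi]; rfl

theorem LSeries_vonMangoldt_eq_integral_psi {s : ℂ} (hs : 1 < s.re) :
    LSeries (fun n => (vonMangoldt n : ℂ)) s =
      s * ∫ t in Set.Ioi (1 : ℝ), (Chebyshev.psi t : ℂ) * (t : ℂ) ^ (-(s + 1)) := by
  have hO : (fun n : ℕ => ∑ k ∈ Icc 1 n, vonMangoldt k) =O[atTop] fun n => (n : ℝ) ^ (1 : ℝ) := by
    refine Asymptotics.IsBigO.of_bound (Real.log 4 + 4) (Eventually.of_forall fun n => ?_)
    have h := sum_vonMangoldt_eq_psi n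
    rw [Nat.floor_natCast] at h
    rw [h, Real.rpow_one, Real.norm_of_nonneg (Chebyshev.psi_nonneg _),
      Real.norm_of_nonneg (Nat.cast_nonneg _)]
    exact Chebyshev.psi_le_const_mul_self (Nat.cast_nonneg _)
  rw [LSeries_eq_mul_integral_of_nonneg _ zero_le_one hs hO fun _ => vonMangoldt_nonneg]
  congr 2
  ext t
  rw [← sum_vonMangoldt_eq_psi, Complex.ofReal_sum]

theorem measurable_psi : Measurable Chebyshev.psi := Chebyshev.psi_mono.measurable

theorem integrableOn_psi_mul_cpow {s : ℂ} (hs : 1 < s.re) :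
    IntegrableOn (fun t : ℝ => (Chebyshev.psi t : ℂ) * (t : ℂ) ^ (-(s + 1))) (Set.Ioi 1) := by
  have h := (integrableOn_Ioi_rpow_of_lt (a := -s.re) (by linarith) zero_lt_one).const_mul
    (Real.log 4 + 4)
  refine Integrable.mono' h ?_ ?_
  · refine ((Complex.measurable_ofReal.comp measurable_psi).mul ?_).aestronglyMeasurable
    fun_prop
  · filter_upwards [ae_restrict_mem measurableSet_Ioi] with t ht
    have ht0 : (0 : ℝ) < t := zero_lt_one.trans ht
    rw [norm_mul, Complex.norm_real, Real.norm_of_nonneg (Chebyshev.psi_nonneg _),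
      Complex.norm_cpow_eq_rpow_re_of_pos ht0]
    have : t ^ (-s.re) = t * t ^ (-(s + 1)).re := by
      rw [← Real.rpow_one_add' ht0.le (by simp; linarith)]
      simp
    rw [this, ← mul_assoc]
    gcongr
    exact Chebyshev.psi_le_const_mul_self ht0.le

theorem integral_psi_sub_eq_psiLaplace {s : ℂ} (hs : 1 < s.re) :
    ∫ t in Set.Ioi (1 : ℝ), ((Chebyshev.psi t : ℂ) / t - 1) * (t : ℂ) ^ (-s) =
      psiLaplace s := by
  have hs0 : s ≠ 0 := by rintro rfl; simp at hs; linarith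
  have hs1 : s ≠ 1 := by rintro rfl; simp at hs
  have hs1' : s - 1 ≠ 0 := sub_ne_zero.2 hs1
  have h1 : ∫ t in Set.Ioi (1 : ℝ), ((Chebyshev.psi t : ℂ) / t - 1) * (t : ℂ) ^ (-s) =
      ∫ t in Set.Ioi (1 : ℝ), ((Chebyshev.psi t : ℂ) * (t : ℂ) ^ (-(s + 1)) - (t : ℂ) ^ (-s)) := by
    refine setIntegral_congr_fun measurableSet_Ioi fun t ht => ?_
    have ht0 : (t : ℂ) ≠ 0 := by exact_mod_cast (zero_lt_one.trans ht).ne'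
    have : (t : ℂ) ^ (-(s + 1)) = (t : ℂ) ^ (-s) / t := by
      rw [neg_add, ← sub_eq_add_neg, Complex.cpow_sub _ _ ht0, Complex.cpow_one]
    simp only [this]
    ring
  have hre : (-s).re < -1 := by simpa using hs
  rw [h1, integral_sub (integrableOn_psi_mul_cpow hs)
    (integrableOn_Ioi_cpow_of_lt hre zero_lt_one), integral_Ioi_cpow_of_lt hre zero_lt_one]
  have h2 := LSeries_vonMangoldt_eq_integral_psi hs
  rw [LSeries_vonMangoldt_eq_deriv_riemannZeta_div hs] at h2
  have h3 : riemannZeta₁ s ≠ 0 := riemannZeta₁_ne_zero_of_one_le_re hs.le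
  rw [deriv_riemannZeta_eq_neg_inv_sub_sq_mul_add hs1, riemannZeta_eq_inv_sub_mul hs1] at h2
  rw [← mul_right_inj' hs0, mul_sub, ← h2, psiLaplace]
  have h4 : -s + 1 ≠ 0 := by rw [neg_add_eq_sub]; exact sub_ne_zero.2 hs1.symm
  simp only [Complex.ofReal_one, Complex.one_cpow]
  field_simp
  ring

theorem fourier_psiErrDamped {ε : ℝ} (hε : 0 < ε) (ξ : ℝ) :
    𝓕 (psiErrDamped ε) ξ = psiLaplace (1 + ε + 2 * Real.pi * ξ * Complex.I) := by
  set g : ℝ → ℂ := fun t => if 1 < t then (Chebyshev.psi t : ℂ) / t - 1 else 0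
  set s : ℂ := ε + 2 * Real.pi * ξ * Complex.I with hs
  have hre : s.re = ε := by simp [s]
  have him : s.im = 2 * Real.pi * ξ := by simp [s]
  have h := mellin_eq_fourier (fun t => g t⁻¹) (s := s)
  have hw : s.im / (2 * Real.pi) = ξ := by
    rw [him]; field_simp
  rw [hw, hre] at h
  have hf : (fun u : ℝ => Real.exp (-ε * u) • g (Real.exp (-u))⁻¹) = psiErrDamped ε := by
    ext u
    rw [← Real.exp_neg, neg_neg]
    simp only [g, psiErrDamped, Real.one_lt_exp_iff, psiErr]
    split_ifs
    · simp
    · simp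
  rw [hf] at h
  rw [← h, mellin_comp_inv, mellin, add_assoc, ← hs, ← integral_psi_sub_eq_psiLaplace
    (by simp [hre, hε])]
  rw [← integral_indicator measurableSet_Ioi, ← integral_indicator measurableSet_Ioi]
  congr 1
  ext t
  simp only [Set.indicator, Set.mem_Ioi, g]
  by_cases h1 : 1 < t
  · simp only [h1, zero_lt_one.trans h1, if_true, smul_eq_mul]
    rw [mul_comm, show -s - 1 = -(1 + s) by ring]
  · simp [h1]

end PsiFourier

section PsiFourierBound

open MeasureTheory
open scoped FourierTransform

theorem abs_psiErr_le (u : ℝ) : |psiErr u| ≤ Real.log 4 + 4 := by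
  have h1 := Chebyshev.psi_le_const_mul_self (Real.exp_pos u).le
  have h2 := Chebyshev.psi_nonneg (Real.exp u)
  have h3 : 0 ≤ Real.log 4 := Real.log_nonneg (by norm_num)
  have h4 : Chebyshev.psi (Real.exp u) / Real.exp u ≤ Real.log 4 + 4 :=
    (div_le_iff₀ (Real.exp_pos u)).2 h1
  have h5 : 0 ≤ Chebyshev.psi (Real.exp u) / Real.exp u := by positivity
  rw [psiErr, abs_le]
  constructor <;> linarith

theorem measurable_psiErr : Measurable psiErr :=
  ((measurable_psi.comp Real.measurable_exp).div Real.measurable_exp).sub_const 1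

theorem measurable_psiErrDamped (ε : ℝ) : Measurable (psiErrDamped ε) := by
  refine Complex.measurable_ofReal.comp (Measurable.ite measurableSet_Ioi ?_ measurable_const)
  exact Measurable.mul (by fun_prop) measurable_psiErr

theorem integrable_pow_smul_psiErrDamped {ε : ℝ} (hε : 0 < ε) (n : ℕ) :
    Integrable fun u : ℝ => u ^ n • psiErrDamped ε u := by
  have h := (integrableOn_rpow_mul_exp_neg_mul_rpow (s := n) (p := 1) (b := ε)
    (by linarith [(Nat.cast_nonneg n : (0 : ℝ) ≤ n)]) zero_lt_one hε).const_mul (Real.log 4 + 4)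
  replace h := (integrable_indicator_iff measurableSet_Ioi).2 h
  refine Integrable.mono' h ?_ (Eventually.of_forall fun u => ?_)
  · exact ((measurable_id.pow_const n).smul (measurable_psiErrDamped ε)).aestronglyMeasurable
  · rw [norm_smul, psiErrDamped, Complex.norm_real, Set.indicator]
    simp only [Set.mem_Ioi]
    split_ifs with hu
    · rw [norm_mul, Real.norm_of_nonneg (by positivity), Real.norm_of_nonneg (Real.exp_pos _).le,
        Real.norm_eq_abs, Real.rpow_natCast, Real.rpow_one]
      have := abs_psiErr_le u
      calc u ^ n * (Real.exp (-ε * u) * |psiErr u|)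
          ≤ u ^ n * (Real.exp (-ε * u) * (Real.log 4 + 4)) := by gcongr
        _ = _ := by ring
    · simp

theorem iteratedDeriv_two_psiLaplace_vertical {σ : ℝ} (hσ : 1 < σ) (b : ℝ) (ξ : ℝ) :
    iteratedDeriv 2 (fun ξ : ℝ => psiLaplace (σ + b * ξ * Complex.I)) ξ =
      (b * Complex.I) ^ 2 * iteratedDeriv 2 psiLaplace (σ + b * ξ * Complex.I) := by
  have hU : IsOpen {s : ℂ | 1 < s.re} := isOpen_lt continuous_const Complex.continuous_re
  have hd : DifferentiableOn ℂ psiLaplace {s : ℂ | 1 < s.re} := fun s hs =>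
    (differentiableAt_psiLaplace (by rintro rfl; simp at hs; linarith)
      (riemannZeta₁_ne_zero_of_one_le_re (le_of_lt hs))).differentiableWithinAt
  have hmem (ξ : ℝ) : (σ + b * ξ * Complex.I : ℂ) ∈ {s : ℂ | 1 < s.re} := by simpa using hσ
  have hlin (ξ : ℝ) : HasDerivAt (fun ξ : ℝ => (σ + b * ξ * Complex.I : ℂ)) (b * Complex.I) ξ := by
    have := (((Complex.ofRealCLM.hasDerivAt (x := ξ)).const_mul (b : ℂ)).mul_const
      Complex.I).const_add (σ : ℂ)
    simpa using this
  have h1 : deriv (fun ξ : ℝ => psiLaplace (σ + b * ξ * Complex.I)) =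
      fun ξ : ℝ => deriv psiLaplace (σ + b * ξ * Complex.I) * (b * Complex.I) := by
    ext ξ
    exact (HasDerivAt.comp ξ ((hd.differentiableAt (hU.mem_nhds (hmem ξ))).hasDerivAt)
      (hlin ξ)).deriv
  rw [iteratedDeriv_succ, iteratedDeriv_one, h1, iteratedDeriv_succ, iteratedDeriv_one]
  have h2 := (HasDerivAt.comp ξ
    (((hd.deriv hU).differentiableAt (hU.mem_nhds (hmem ξ))).hasDerivAt) (hlin ξ)).mul_const
      (b * Complex.I)
  refine h2.deriv.trans ?_
  ring

theorem exists_norm_fourier_sq_smul_psiErrDamped_le :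
    ∃ C > 0, ∀ ε : ℝ, 0 < ε → ε ≤ 1 → ∀ ξ : ℝ,
      ‖𝓕 (fun u : ℝ => u ^ 2 • psiErrDamped ε u) ξ‖ ≤ C * (1 + |ξ|) ^ (-(3 / 4) : ℝ) := by
  obtain ⟨C, hC, h⟩ := exists_norm_iteratedDeriv_psiLaplace_le (θ := 1 / 100) (by norm_num)
    (by norm_num)
  refine ⟨C, hC, fun ε hε hε1 ξ => ?_⟩
  have h1 := Real.iteratedDeriv_fourier (f := psiErrDamped ε) (N := 2) (n := 2)
    (fun n _ => integrable_pow_smul_psiErrDamped hε n) (by norm_num)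
  have h2 : 𝓕 (psiErrDamped ε) = fun ξ : ℝ =>
      psiLaplace ((1 + ε : ℝ) + (2 * Real.pi : ℝ) * ξ * Complex.I) := by
    ext ξ
    rw [fourier_psiErrDamped hε]
    push_cast
    rfl
  have h3 := congrFun h1 ξ
  rw [h2, iteratedDeriv_two_psiLaplace_vertical (by linarith)] at h3
  have h4 : 𝓕 (fun x : ℝ => (-2 * Real.pi * Complex.I * x : ℂ) ^ 2 • psiErrDamped ε x) ξ =
      ((2 * Real.pi : ℝ) * Complex.I) ^ 2 * 𝓕 (fun u : ℝ => u ^ 2 • psiErrDamped ε u) ξ := by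
    simp only [Real.fourier_real_eq_integral_exp_smul]
    rw [← integral_const_mul]
    congr 1
    ext v
    simp only [smul_eq_mul, Complex.real_smul]
    push_cast
    ring
  rw [h4] at h3
  have h5 := mul_left_cancel₀ (pow_ne_zero 2 (mul_ne_zero (by
    exact_mod_cast Real.two_pi_pos.ne') Complex.I_ne_zero)) h3
  rw [← h5]
  refine (h _ (by simp [hε]) (by simp; linarith)).trans ?_
  have him : ((1 + ε : ℝ) + (2 * Real.pi : ℝ) * ξ * Complex.I : ℂ).im = 2 * Real.pi * ξ := by
    simp
  rw [him]
  refine mul_le_mul_of_nonneg_left ?_ hC.le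
  have hpi : 1 ≤ 2 * Real.pi := by linarith [Real.pi_gt_three]
  have hξ : 1 + |ξ| ≤ 1 + |2 * Real.pi * ξ| := by
    rw [abs_mul, abs_of_pos Real.two_pi_pos]
    nlinarith [abs_nonneg ξ]
  calc (1 + |2 * Real.pi * ξ|) ^ (15 * (1 / 100) - 1 : ℝ)
      ≤ (1 + |ξ|) ^ (15 * (1 / 100) - 1 : ℝ) :=
        Real.rpow_le_rpow_of_nonpos (by positivity) hξ (by norm_num)
    _ ≤ (1 + |ξ|) ^ (-(3 / 4) : ℝ) :=
        Real.rpow_le_rpow_of_exponent_le (by linarith [abs_nonneg ξ]) (by norm_num)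

end PsiFourierBound

section PsiDuality

open MeasureTheory SchwartzMap
open scoped FourierTransform ContDiff

theorem integral_fourier_mul_schwartzMap {f : ℝ → ℂ} (hf : Integrable f) (g : 𝓢(ℝ, ℂ)) :
    ∫ ξ, 𝓕 f ξ * g ξ = ∫ x, f x * 𝓕 g x := by
  simpa using! VectorFourier.integral_bilin_fourierIntegral_eq_flip (.mul ℂ ℂ) (L := innerₗ ℝ)
    Real.continuous_fourierChar continuous_inner hf g.integrable

theorem norm_integral_mul_schwartzMap_le {f : ℝ → ℂ} (hf : Integrable f) {b : ℝ → ℝ}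
    (hb : MemLp b 2) (hfb : ∀ ξ, ‖𝓕 f ξ‖ ≤ b ξ) (g : 𝓢(ℝ, ℂ)) :
    ‖∫ x, f x * g x‖ ≤ √(∫ ξ, b ξ ^ 2) * √(∫ x, ‖g x‖ ^ 2) := by
  set k : 𝓢(ℝ, ℂ) := 𝓕⁻ g with hk
  have hgk : 𝓕 k = g := FourierTransform.fourier_fourierInv_eq g
  have h1 := integral_fourier_mul_schwartzMap hf k
  rw [hgk] at h1
  have h2 : ∫ x, ‖g x‖ ^ 2 = ∫ x, ‖k x‖ ^ 2 := by
    rw [← hgk]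
    exact integral_norm_sq_fourier k
  have hb0 (ξ : ℝ) : 0 ≤ b ξ := (norm_nonneg _).trans (hfb ξ)
  have hk2 : MemLp (fun x => ‖k x‖) 2 := (k.memLp 2).norm
  rw [← h1, h2]
  calc ‖∫ ξ, 𝓕 f ξ * k ξ‖ ≤ ∫ ξ, b ξ * ‖k ξ‖ := by
        refine norm_integral_le_of_norm_le (hb.integrable_mul hk2) (Eventually.of_forall fun ξ => ?_)
        rw [norm_mul]
        exact mul_le_mul_of_nonneg_right (hfb ξ) (norm_nonneg _)
    _ ≤ (∫ ξ, b ξ ^ (2 : ℝ)) ^ (1 / 2 : ℝ) * (∫ x, ‖k x‖ ^ (2 : ℝ)) ^ (1 / 2 : ℝ) := by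
        refine integral_mul_le_Lp_mul_Lq_of_nonneg Real.HolderConjugate.two_two
          (Eventually.of_forall hb0) (Eventually.of_forall fun _ => norm_nonneg _) ?_ ?_ <;>
        simpa
    _ = _ := by simp only [Real.sqrt_eq_rpow, Real.rpow_two]

theorem exists_abs_integral_psiErr_mul_le :
    ∃ D > 0, ∀ ε : ℝ, 0 < ε → ε ≤ 1 → ∀ φ : ℝ → ℝ, ContDiff ℝ ∞ φ → HasCompactSupport φ →
      |∫ u in Set.Ioi (0 : ℝ), u ^ 2 * Real.exp (-ε * u) * psiErr u * φ u| ≤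
        D * √(∫ u, φ u ^ 2) := by
  obtain ⟨C, hC, h⟩ := exists_norm_fourier_sq_smul_psiErrDamped_le
  set b : ℝ → ℝ := fun ξ => C * (1 + |ξ|) ^ (-(3 / 4) : ℝ) with hb
  have hbm : MemLp b 2 := by
    refine (MemLp.const_mul ?_ C)
    rw [memLp_two_iff_integrable_sq
      (Measurable.aestronglyMeasurable (Measurable.pow_const (by fun_prop) _))]
    have := integrable_one_add_norm (E := ℝ) (μ := volume) (r := 3 / 2) (by norm_num)
    refine this.congr (Eventually.of_forall fun ξ => ?_)
    have h0 : 0 ≤ 1 + |ξ| := by positivity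
    simp only [Real.norm_eq_abs]
    rw [← Real.rpow_mul_natCast h0]
    norm_num
  refine ⟨√(∫ ξ, b ξ ^ 2) + 1, by positivity, fun ε hε hε1 φ hφ hφc => ?_⟩
  have hc : HasCompactSupport fun u => (φ u : ℂ) := hφc.comp_left Complex.ofReal_zero
  have hs : ContDiff ℝ ∞ fun u => (φ u : ℂ) := Complex.ofRealCLM.contDiff.comp hφ
  have h1 := norm_integral_mul_schwartzMap_le (integrable_pow_smul_psiErrDamped hε 2) hbm
    (h ε hε hε1) (hc.toSchwartzMap hs)
  simp only [HasCompactSupport.toSchwartzMap_toFun, Complex.norm_real, Real.norm_eq_abs,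
    sq_abs] at h1
  have h2 : ∫ u : ℝ, u ^ 2 • psiErrDamped ε u * (φ u : ℂ) =
      ((∫ u in Set.Ioi (0 : ℝ), u ^ 2 * Real.exp (-ε * u) * psiErr u * φ u : ℝ) : ℂ) := by
    rw [← integral_indicator measurableSet_Ioi, ← integral_complex_ofReal]
    congr 1
    ext u
    simp only [psiErrDamped, Set.indicator, Set.mem_Ioi]
    split_ifs
    · rw [Complex.real_smul]
      push_cast
      ring
    · simp
  rw [h2, Complex.norm_real, Real.norm_eq_abs] at h1
  refine h1.trans ?_
  gcongr
  linarith

end PsiDuality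

section PsiTauberian

open MeasureTheory
open scoped ContDiff

theorem psiErr_add_one_nonneg (u : ℝ) : 0 ≤ psiErr u + 1 := by
  rw [psiErr, sub_add_cancel]
  exact div_nonneg (Chebyshev.psi_nonneg _) (Real.exp_pos u).le

theorem psiErr_add_one_mul_exp_le {u v : ℝ} (huv : u ≤ v) :
    (psiErr u + 1) * Real.exp (u - v) ≤ psiErr v + 1 := by
  have h := Chebyshev.psi_mono (Real.exp_le_exp.2 huv)
  simp only [psiErr, sub_add_cancel]
  rw [Real.exp_sub, div_mul_div_comm, mul_comm (Real.exp u), ← div_mul_div_comm,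
    div_self (Real.exp_pos u).ne', mul_one]
  gcongr

/-- If `psiErr` is large at a point, it stays large, with a constant sign, on an interval whose
length is proportional to its size. -/
theorem exists_forall_half_abs_psiErr_le (u₀ : ℝ) {h : ℝ}
    (hh : h = |psiErr u₀| / (2 * (1 + (Real.log 4 + 4)))) :
    ∃ s c : ℝ, |s| = 1 ∧ |c - u₀| = h / 2 ∧
      ∀ u, |u - c| ≤ h / 2 → |psiErr u₀| / 2 ≤ s * psiErr u := by
  have hK : 0 < 1 + (Real.log 4 + 4) := by
    linarith [Real.log_nonneg (show (1 : ℝ) ≤ 4 by norm_num)]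
  have hh0 : 0 ≤ h := by rw [hh]; positivity
  have hhK : h * (1 + (Real.log 4 + 4)) = |psiErr u₀| / 2 := by
    rw [hh]; field_simp
  rcases le_total 0 (psiErr u₀) with he | he
  · refine ⟨1, u₀ + h / 2, abs_one, by rw [add_sub_cancel_left, abs_of_nonneg (by linarith)],
      fun u hu => ?_⟩
    rw [abs_le] at hu
    have h1 := psiErr_add_one_mul_exp_le (show u₀ ≤ u by linarith)
    have h2 := Real.add_one_le_exp (u₀ - u)
    have h3 := mul_le_mul_of_nonneg_left (show 1 - h ≤ Real.exp (u₀ - u) by linarith)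
      (psiErr_add_one_nonneg u₀)
    have h4 := mul_le_mul_of_nonneg_left ((le_abs_self _).trans (abs_psiErr_le u₀)) hh0
    rw [abs_of_nonneg he] at hhK ⊢
    linarith
  · refine ⟨-1, u₀ - h / 2, by simp, by
      rw [sub_sub_cancel_left, abs_neg, abs_of_nonneg (by linarith)], fun u hu => ?_⟩
    rw [abs_le] at hu
    have h1 := psiErr_add_one_mul_exp_le (show u ≤ u₀ by linarith)
    have h2 := Real.add_one_le_exp (u - u₀)
    have h3 := mul_le_mul_of_nonneg_left (show 1 - h ≤ Real.exp (u - u₀) by linarith)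
      (psiErr_add_one_nonneg u)
    have h4 := mul_le_mul_of_nonneg_left ((le_abs_self _).trans (abs_psiErr_le u)) hh0
    rw [abs_of_nonpos he] at hhK ⊢
    linarith

theorem integrable_mul_psiErr_mul {w φ : ℝ → ℝ} (hw : Continuous w) (hφ : Continuous φ)
    (hφc : HasCompactSupport φ) : Integrable fun u => w u * psiErr u * φ u := by
  have h1 : Integrable fun u => w u * φ u :=
    (hw.mul hφ).integrable_of_hasCompactSupport hφc.mul_left
  have h2 := h1.bdd_mul (f := psiErr) measurable_psiErr.aestronglyMeasurable
    (Eventually.of_forall abs_psiErr_le)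
  exact h2.congr (Eventually.of_forall fun u => by ring)

theorem integral_contDiffBump_sq_le {c : ℝ} (φ : ContDiffBump c) :
    ∫ u, φ u ^ 2 ≤ ∫ u, φ u := by
  have h : HasCompactSupport fun u => φ u ^ 2 :=
    φ.hasCompactSupport.comp_left (g := fun x : ℝ => x ^ 2) (zero_pow two_ne_zero)
  exact integral_mono ((φ.continuous.pow 2).integrable_of_hasCompactSupport h) φ.integrable
    fun u => pow_le_of_le_one φ.nonneg φ.le_one two_ne_zero

theorem mul_integral_contDiffBump_le {c m s : ℝ} (φ : ContDiffBump c) {F : ℝ → ℝ}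
    (hF : Integrable fun u => F u * φ u)
    (hpt : ∀ u, |u - c| ≤ φ.rOut → 0 < u ∧ m ≤ s * F u) :
    m * ∫ u, φ u ≤ s * ∫ u in Set.Ioi (0 : ℝ), F u * φ u := by
  rw [← integral_indicator measurableSet_Ioi, ← integral_const_mul, ← integral_const_mul]
  refine integral_mono (φ.integrable.const_mul _)
    ((hF.indicator measurableSet_Ioi).const_mul s) fun u => ?_
  by_cases hu : |u - c| ≤ φ.rOut
  · obtain ⟨hu1, hu2⟩ := hpt u hu
    have hu0 : u ∈ Set.Ioi (0 : ℝ) := hu1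
    simp only [Set.indicator_of_mem hu0]
    rw [← mul_assoc]
    exact mul_le_mul_of_nonneg_right hu2 φ.nonneg
  · have h0 : φ u = 0 := φ.zero_of_le_dist (by rw [Real.dist_eq]; exact (not_le.1 hu).le)
    simp [Set.indicator, h0]

theorem exists_abs_psiErr_le_div : ∃ C > 0, ∀ u : ℝ, 1 ≤ u → |psiErr u| ≤ C / u := by
  obtain ⟨D, hD, hDb⟩ := exists_abs_integral_psiErr_mul_le
  set K : ℝ := 1 + (Real.log 4 + 4) with hKdef
  have hK : 5 ≤ K := by
    linarith [Real.log_nonneg (show (1 : ℝ) ≤ 4 by norm_num)]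
  refine ⟨1 + (24 * D) ^ 2 * (4 * K), by positivity, fun u₀ hu₀ => ?_⟩
  set e := |psiErr u₀| with he
  rcases (abs_nonneg (psiErr u₀)).eq_or_lt with h0 | hpos
  · rw [he, ← h0]; positivity
  rw [← he] at hpos
  have heK : e ≤ K := by linarith [abs_psiErr_le u₀]
  set h := e / (2 * K) with hh
  obtain ⟨s, c, hs, hc, hwin⟩ := exists_forall_half_abs_psiErr_le u₀ hh
  have hh0 : 0 < h := by positivity
  have hh1 : h ≤ 1 / 2 := by
    rw [hh, div_le_iff₀ (by positivity)]; linarith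
  let φ : ContDiffBump c := ⟨h / 4, h / 2, by positivity, by linarith⟩
  set J := ∫ u, φ u with hJ
  have hJh : h / 2 ≤ J := by
    have := φ.measure_closedBall_le_integral volume
    rw [Measure.real, Real.volume_closedBall, ENNReal.toReal_ofReal (by positivity)] at this
    change 2 * (h / 4) ≤ J at this
    linarith
  have hJ0 : 0 < J := by linarith
  have hφ2 : ∫ u, φ u ^ 2 ≤ J := integral_contDiffBump_sq_le φ
  set ε := 1 / (u₀ + 1 / 2) with hε
  have hε0 : 0 < ε := by positivity
  have hε1 : ε ≤ 1 := by
    rw [hε, div_le_one (by linarith)]; linarith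
  have hw : Continuous fun u : ℝ => u ^ 2 * Real.exp (-ε * u) := by fun_prop
  have hint := integrable_mul_psiErr_mul hw φ.continuous φ.hasCompactSupport
  have hupper := hDb ε hε0 hε1 φ φ.contDiff φ.hasCompactSupport
  have hpt (u : ℝ) (hu : |u - c| ≤ h / 2) : 1 / 2 ≤ u ∧
      u₀ ^ 2 * e / 24 ≤ s * (u ^ 2 * Real.exp (-ε * u) * psiErr u) := by
    have h1 := hwin u hu
    have hc2 := hc.le
    rw [abs_le] at hu hc2
    have h2 : u₀ / 2 ≤ u := by linarith
    have h3 : 1 / 3 ≤ Real.exp (-ε * u) := by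
      have hle : ε * u ≤ 1 := by
        rw [hε, one_div_mul_eq_div, div_le_one (by linarith)]; linarith
      have h4 : Real.exp (-1) ≤ Real.exp (-ε * u) := Real.exp_le_exp.2 (by linarith)
      have h5 : 1 / 3 ≤ Real.exp (-1) := by
        rw [Real.exp_neg, one_div]
        exact inv_anti₀ (Real.exp_pos 1) (by linarith [Real.exp_one_lt_d9])
      exact h5.trans h4
    refine ⟨by linarith, ?_⟩
    calc u₀ ^ 2 * e / 24 = (u₀ / 2) ^ 2 * (1 / 3) * (e / 2) := by ring
      _ ≤ u ^ 2 * Real.exp (-ε * u) * (s * psiErr u) := by gcongr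
      _ = _ := by ring
  have hlower : u₀ ^ 2 * e / 24 * J ≤
      s * ∫ u in Set.Ioi (0 : ℝ), u ^ 2 * Real.exp (-ε * u) * psiErr u * φ u := by
    refine mul_integral_contDiffBump_le φ hint fun u hu => ?_
    obtain ⟨hu1, hu2⟩ := hpt u hu
    exact ⟨by linarith, hu2⟩
  have hfinal : u₀ ^ 2 * e / 24 * J ≤ D * √J := by
    refine hlower.trans ((le_abs_self _).trans ?_)
    rw [abs_mul, hs, one_mul]
    exact hupper.trans (by gcongr)
  have hsq : √J * √J = J := Real.mul_self_sqrt hJ0.le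
  have hsJ : 0 < √J := Real.sqrt_pos.2 hJ0
  have h6 : u₀ ^ 2 * e * √J ≤ 24 * D := by
    have : u₀ ^ 2 * e / 24 * √J ≤ D := by
      refine le_of_mul_le_mul_right ?_ hsJ
      rwa [mul_assoc, hsq]
    linarith
  have h7 : (u₀ ^ 2 * e) ^ 2 * J ≤ (24 * D) ^ 2 := by
    have := pow_le_pow_left₀ (by positivity) h6 2
    rwa [mul_pow, Real.sq_sqrt hJ0.le] at this
  have h8 : (u₀ * e) ^ 3 ≤ (24 * D) ^ 2 * (4 * K) := by
    have h9 : e = h * (2 * K) := by rw [hh]; field_simp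
    calc (u₀ * e) ^ 3 = u₀ ^ 3 * e ^ 2 * e := by ring
      _ ≤ u₀ ^ 4 * e ^ 2 * e := by gcongr; norm_num
      _ = (u₀ ^ 2 * e) ^ 2 * (h / 2) * (4 * K) := by nth_rewrite 2 [h9]; ring
      _ ≤ (u₀ ^ 2 * e) ^ 2 * J * (4 * K) := by gcongr
      _ ≤ _ := by gcongr
  rw [le_div_iff₀ (by linarith), mul_comm]
  by_contra! hcon
  have h10 : 1 ≤ u₀ * e := by
    have : 0 ≤ (24 * D) ^ 2 * (4 * K) := by positivity
    linarith
  linarith [le_self_pow₀ h10 three_ne_zero]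

/-- The prime number theorem for `ψ`, with error term `O (x / log x)`. -/
theorem exists_abs_psi_sub_le :
    ∃ C > 0, ∀ x : ℝ, 3 ≤ x → |Chebyshev.psi x - x| ≤ C * (x / Real.log x) := by
  obtain ⟨C, hC, h⟩ := exists_abs_psiErr_le_div
  refine ⟨C, hC, fun x hx => ?_⟩
  have hx0 : 0 < x := by linarith
  have hlog : 1 ≤ Real.log x := by
    rw [Real.le_log_iff_exp_le hx0]
    linarith [Real.exp_one_lt_d9]
  have h1 := h _ hlog
  rw [psiErr, Real.exp_log hx0] at h1
  calc |Chebyshev.psi x - x| = |Chebyshev.psi x / x - 1| * x := by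
        rw [← abs_of_pos hx0, ← abs_mul, abs_of_pos hx0, sub_mul, one_mul,
          div_mul_cancel₀ _ hx0.ne']
    _ ≤ C / Real.log x * x := by gcongr
    _ = _ := by ring

end PsiTauberian

section RpowDivLog

open MeasureTheory

/-- The comparison function `x ^ β / (log x) ^ m`. -/
noncomputable def rpowDivLog (β : ℝ) (m : ℕ) (x : ℝ) : ℝ := x ^ β / Real.log x ^ m

theorem log_pos_of_two_le {x : ℝ} (hx : 2 ≤ x) : 0 < Real.log x := Real.log_pos (by linarith)

theorem rpowDivLog_pos (β : ℝ) (m : ℕ) {x : ℝ} (hx : 2 ≤ x) : 0 < rpowDivLog β m x := by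
  have := log_pos_of_two_le hx
  have : 0 < x := by linarith
  unfold rpowDivLog
  positivity

theorem rpowDivLog_mul_rpowDivLog (a b : ℝ) (m n : ℕ) {x : ℝ} (hx : 2 ≤ x) :
    rpowDivLog a m x * rpowDivLog b n x = rpowDivLog (a + b) (m + n) x := by
  rw [rpowDivLog, rpowDivLog, rpowDivLog, div_mul_div_comm, ← Real.rpow_add (by linarith),
    ← pow_add]

theorem mul_rpowDivLog (β : ℝ) (m : ℕ) {x : ℝ} (hx : 2 ≤ x) :
    x * rpowDivLog β m x = rpowDivLog (β + 1) m x := by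
  have := rpowDivLog_mul_rpowDivLog 1 β 0 m hx
  rwa [rpowDivLog, Real.rpow_one, pow_zero, div_one, zero_add, add_comm 1 β] at this

theorem rpowDivLog_succ_le (β : ℝ) (m : ℕ) {x : ℝ} (hx : 2 ≤ x) :
    rpowDivLog β (m + 1) x ≤ (Real.log 2)⁻¹ * rpowDivLog β m x := by
  have h := rpowDivLog_mul_rpowDivLog 0 β 1 m hx
  rw [rpowDivLog, Real.rpow_zero, pow_one, zero_add, add_comm 1 m, one_div] at h
  rw [← h]
  have h2 : 0 < Real.log 2 := log_pos_of_two_le le_rfl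
  have := rpowDivLog_pos β m hx
  gcongr

theorem hasDerivAt_rpowDivLog (β : ℝ) (m : ℕ) {x : ℝ} (hx : 2 ≤ x) :
    HasDerivAt (rpowDivLog β m)
      (β * rpowDivLog (β - 1) m x - m * rpowDivLog (β - 1) (m + 1) x) x := by
  have hL := log_pos_of_two_le hx
  have hx0 : 0 < x := by linarith
  have h := (Real.hasDerivAt_rpow_const (p := β) (Or.inl hx0.ne')).div
    ((Real.hasDerivAt_log hx0.ne').pow m) (pow_pos hL m).ne'
  refine h.congr_deriv ?_
  simp only [rpowDivLog, Real.rpow_sub_one hx0.ne', Pi.pow_apply]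
  rcases m with _ | m
  · simp
  · rw [Nat.add_sub_cancel]
    field_simp
    ring

theorem continuousOn_rpowDivLog (β : ℝ) (m : ℕ) : ContinuousOn (rpowDivLog β m) (Set.Ici 2) :=
  fun _ hx => (hasDerivAt_rpowDivLog β m hx).continuousAt.continuousWithinAt

theorem exists_rpowDivLog_le {β : ℝ} (hβ : 0 < β) (m : ℕ) :
    ∃ C > 0, ∀ t x : ℝ, 2 ≤ t → t ≤ x → rpowDivLog β m t ≤ C * rpowDivLog β m x := by
  set δ : ℝ := β / (m + 1) with hδ
  have hδ0 : 0 < δ := by positivity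
  have h2 : 0 < Real.log 2 := log_pos_of_two_le le_rfl
  set A : ℝ := 1 + 1 / (δ * Real.log 2) with hA
  refine ⟨A ^ m, by positivity, fun t x ht hx => ?_⟩
  have ht0 : 0 < t := by linarith
  have hx0 : 0 < x := by linarith
  have hLt : Real.log 2 ≤ Real.log t := Real.log_le_log two_pos ht
  have hLt0 := h2.trans_le hLt
  have hxt : 1 ≤ x / t := (one_le_div ht0).2 hx
  set y := Real.log (x / t) with hy
  have hy0 : 0 ≤ y := Real.log_nonneg hxt
  have hLx : Real.log x = Real.log t + y := by
    rw [hy, Real.log_div hx0.ne' ht0.ne']; ring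
  have hexp : 1 + δ * y ≤ (x / t) ^ δ := by
    rw [Real.rpow_def_of_pos (by positivity), ← hy, mul_comm y]
    linarith [Real.add_one_le_exp (δ * y)]
  have h1 : Real.log x ≤ A * (x / t) ^ δ * Real.log t := by
    calc Real.log x = (1 + y / Real.log t) * Real.log t := by rw [hLx]; field_simp
      _ ≤ (1 + y / Real.log 2) * Real.log t := by gcongr
      _ ≤ (A * (1 + δ * y)) * Real.log t := by
        gcongr
        have : A * (1 + δ * y) = 1 + y / Real.log 2 + (δ * y + 1 / (δ * Real.log 2)) := by
          rw [hA]; field_simp; ring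
        rw [this]
        have : 0 ≤ δ * y + 1 / (δ * Real.log 2) := by positivity
        linarith
      _ ≤ _ := by gcongr
  have hδm : δ * m ≤ β := by
    rw [hδ, div_mul_eq_mul_div, div_le_iff₀ (by positivity)]
    nlinarith
  have h3 : Real.log x ^ m ≤ A ^ m * (x / t) ^ β * Real.log t ^ m := by
    calc Real.log x ^ m ≤ (A * (x / t) ^ δ * Real.log t) ^ m :=
          pow_le_pow_left₀ (log_pos_of_two_le (ht.trans hx)).le h1 m
      _ = A ^ m * (x / t) ^ (δ * m) * Real.log t ^ m := by
        rw [mul_pow, mul_pow, ← Real.rpow_mul_natCast (by positivity)]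
      _ ≤ _ := by
        gcongr
  rw [Real.div_rpow hx0.le ht0.le] at h3
  have hLx0 := log_pos_of_two_le (ht.trans hx)
  rw [rpowDivLog, rpowDivLog, div_le_iff₀ (by positivity)]
  have htβ : 0 < t ^ β := by positivity
  calc t ^ β = t ^ β * Real.log x ^ m / Real.log x ^ m := by field_simp
    _ ≤ t ^ β * (A ^ m * (x ^ β / t ^ β) * Real.log t ^ m) / Real.log x ^ m := by gcongr
    _ = _ := by field_simp

theorem exists_rpowDivLog_le_add_one (β : ℝ) (m n : ℕ) :
    ∃ C > 0, ∀ x : ℝ, 2 ≤ x → rpowDivLog β m x ≤ C * rpowDivLog (β + 1) n x := by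
  obtain ⟨C, hC, h⟩ := exists_rpowDivLog_le zero_lt_one n
  have h0 := rpowDivLog_pos 1 n (le_refl (2 : ℝ))
  have h2 : 0 < Real.log 2 := log_pos_of_two_le le_rfl
  refine ⟨C / rpowDivLog 1 n 2 / Real.log 2 ^ m, by positivity, fun x hx => ?_⟩
  have hx0 : 0 < x := by linarith
  have h1 : 1 ≤ C / rpowDivLog 1 n 2 * rpowDivLog 1 n x := by
    rw [div_mul_eq_mul_div, one_le_div h0]
    exact h 2 x le_rfl hx
  have h3 := rpowDivLog_mul_rpowDivLog β 1 0 n hx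
  rw [zero_add] at h3
  calc rpowDivLog β m x ≤ x ^ β / Real.log 2 ^ m := by
        unfold rpowDivLog; gcongr
    _ = rpowDivLog β 0 x * 1 / Real.log 2 ^ m := by simp [rpowDivLog]
    _ ≤ rpowDivLog β 0 x * (C / rpowDivLog 1 n 2 * rpowDivLog 1 n x) / Real.log 2 ^ m := by
        have := rpowDivLog_pos β 0 hx
        gcongr
    _ = _ := by rw [← h3]; ring

theorem intervalIntegrable_rpowDivLog (β : ℝ) (m : ℕ) {x : ℝ} (hx : 2 ≤ x) :
    IntervalIntegrable (rpowDivLog β m) volume 2 x :=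
  ((continuousOn_rpowDivLog β m).mono fun t ht => by
    rw [Set.uIcc_of_le hx] at ht; exact ht.1).intervalIntegrable

theorem exists_integral_rpowDivLog_le {β : ℝ} (hβ : 0 < β) (m : ℕ) :
    ∃ C > 0, ∀ x : ℝ, 2 ≤ x →
      ∫ t in (2 : ℝ)..x, rpowDivLog β m t ≤ C * rpowDivLog (β + 1) m x := by
  obtain ⟨C, hC, h⟩ := exists_rpowDivLog_le hβ m
  refine ⟨C, hC, fun x hx => ?_⟩
  have h0 := rpowDivLog_pos β m hx
  calc ∫ t in (2 : ℝ)..x, rpowDivLog β m t ≤ ∫ t in (2 : ℝ)..x, C * rpowDivLog β m x :=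
        intervalIntegral.integral_mono_on hx (intervalIntegrable_rpowDivLog β m hx)
          intervalIntegrable_const fun t ht => h t x ht.1 ht.2
    _ = (x - 2) * (C * rpowDivLog β m x) := by
        rw [intervalIntegral.integral_const, smul_eq_mul]
    _ ≤ x * (C * rpowDivLog β m x) := by gcongr; linarith
    _ = _ := by rw [← mul_rpowDivLog β m hx]; ring

theorem exists_abs_integral_rpowDivLog_sub_le {β : ℝ} (hβ : 0 < β) (m : ℕ) :
    ∃ C > 0, ∀ x : ℝ, 2 ≤ x →
      |(∫ t in (2 : ℝ)..x, rpowDivLog β m t) - rpowDivLog (β + 1) m x / (β + 1)| ≤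
        C * rpowDivLog (β + 1) (m + 1) x := by
  obtain ⟨C₁, hC₁, h₁⟩ := exists_integral_rpowDivLog_le hβ (m + 1)
  obtain ⟨C₂, hC₂, h₂⟩ := exists_rpowDivLog_le (show 0 < β + 1 by linarith) (m + 1)
  have h2 : 0 < Real.log 2 := log_pos_of_two_le le_rfl
  refine ⟨Real.log 2 * C₂ + m * C₁, by positivity, fun x hx => ?_⟩
  have hFTC := intervalIntegral.integral_eq_sub_of_hasDerivAt (a := 2) (b := x)
    (f := rpowDivLog (β + 1) m) (fun t ht => hasDerivAt_rpowDivLog (β + 1) m (by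
      rw [Set.uIcc_of_le hx] at ht; exact ht.1))
    (((intervalIntegrable_rpowDivLog _ _ hx).const_mul _).sub
      ((intervalIntegrable_rpowDivLog _ _ hx).const_mul _))
  rw [add_sub_cancel_right, intervalIntegral.integral_sub
    ((intervalIntegrable_rpowDivLog _ _ hx).const_mul _)
    ((intervalIntegrable_rpowDivLog _ _ hx).const_mul _), intervalIntegral.integral_const_mul,
    intervalIntegral.integral_const_mul] at hFTC
  set I₀ := ∫ t in (2 : ℝ)..x, rpowDivLog β m t
  set I₁ := ∫ t in (2 : ℝ)..x, rpowDivLog β (m + 1) t with hI₁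
  have hI₁0 : 0 ≤ I₁ := intervalIntegral.integral_nonneg hx
    fun t ht => (rpowDivLog_pos _ _ ht.1).le
  have hb : rpowDivLog (β + 1) m 2 ≤ Real.log 2 * C₂ * rpowDivLog (β + 1) (m + 1) x := by
    have : rpowDivLog (β + 1) m 2 = Real.log 2 * rpowDivLog (β + 1) (m + 1) 2 := by
      simp only [rpowDivLog]; field_simp; ring
    rw [this, mul_assoc]
    exact mul_le_mul_of_nonneg_left (h₂ 2 x le_rfl hx) h2.le
  have hb0 := rpowDivLog_pos (β + 1) m (le_refl (2 : ℝ))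
  have hmI : m * I₁ ≤ m * C₁ * rpowDivLog (β + 1) (m + 1) x := by
    rw [mul_assoc]
    exact mul_le_mul_of_nonneg_left (h₁ x hx) (Nat.cast_nonneg m)
  have hβ1 : 1 ≤ β + 1 := by linarith
  have heq : I₀ - rpowDivLog (β + 1) m x / (β + 1) =
      (m * I₁ - rpowDivLog (β + 1) m 2) / (β + 1) := by
    field_simp
    linarith
  rw [heq, abs_div, abs_of_pos (show 0 < β + 1 by linarith)]
  refine (div_le_self (abs_nonneg _) hβ1).trans ?_
  rw [add_mul]
  have : (0 : ℝ) ≤ m * I₁ := by positivity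
  rw [abs_le]
  constructor <;> linarith

end RpowDivLog

section PrimeSums

open MeasureTheory

/-- The prime number theorem for `θ`, with error term `O (x / log x)`. -/
theorem exists_abs_theta_sub_le :
    ∃ C > 0, ∀ x : ℝ, 2 ≤ x → |Chebyshev.theta x - x| ≤ C * rpowDivLog 1 1 x := by
  obtain ⟨C₁, hC₁, h₁⟩ := exists_abs_psi_sub_le
  obtain ⟨C₂, h₂⟩ := Chebyshev.psi_sub_theta_le_mul_sqrt
  have hlog4 : 0 ≤ Real.log 4 := Real.log_nonneg (by norm_num)
  obtain ⟨C₃, hC₃, h₃⟩ := exists_rpowDivLog_le_add_one 0 0 1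
  refine ⟨C₁ + 3 * (Real.log 4 + 5) * C₃ + 2 * |C₂|, by positivity, fun x hx => ?_⟩
  have hx0 : 0 < x := by linarith
  have hL := log_pos_of_two_le hx
  have hr := rpowDivLog_pos 1 1 hx
  have hψ : |Chebyshev.psi x - x| ≤ (C₁ + 3 * (Real.log 4 + 5) * C₃) * rpowDivLog 1 1 x := by
    rcases le_total 3 x with h3 | h3
    · have := h₁ x h3
      rw [show x / Real.log x = rpowDivLog 1 1 x by simp [rpowDivLog]] at this
      refine this.trans ?_
      gcongr
      have : 0 ≤ 3 * (Real.log 4 + 5) * C₃ := by positivity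
      linarith
    · have hle := Chebyshev.psi_le_const_mul_self hx0.le
      have h0 := Chebyshev.psi_nonneg x
      have h4 : |Chebyshev.psi x - x| ≤ 3 * (Real.log 4 + 5) := by
        have : (Real.log 4 + 4) * x ≤ (Real.log 4 + 4) * 3 := by gcongr
        rw [abs_le]
        constructor <;> linarith
      have h5 := h₃ x hx
      rw [zero_add, rpowDivLog, Real.rpow_zero, pow_zero, div_one] at h5
      calc |Chebyshev.psi x - x| ≤ 3 * (Real.log 4 + 5) * 1 := by linarith
        _ ≤ 3 * (Real.log 4 + 5) * (C₃ * rpowDivLog 1 1 x) := by gcongr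
        _ ≤ _ := by
          rw [← mul_assoc]
          gcongr
          linarith
  have hθ : |Chebyshev.psi x - Chebyshev.theta x| ≤ 2 * |C₂| * rpowDivLog 1 1 x := by
    rw [abs_of_nonneg (sub_nonneg.2 (Chebyshev.theta_le_psi x))]
    have hsq : √x * Real.log x ≤ 2 * x := by
      have h6 := Real.log_le_sub_one_of_pos (Real.sqrt_pos.2 hx0)
      rw [Real.log_sqrt hx0.le] at h6
      have h7 : Real.log x ≤ 2 * √x := by linarith
      calc √x * Real.log x ≤ √x * (2 * √x) := by gcongr
        _ = 2 * x := by rw [mul_left_comm, Real.mul_self_sqrt hx0.le]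
    have hsq' : √x ≤ 2 * rpowDivLog 1 1 x := by
      rw [rpowDivLog, Real.rpow_one, pow_one, ← mul_div_assoc, le_div_iff₀ hL]
      exact hsq
    calc Chebyshev.psi x - Chebyshev.theta x ≤ C₂ * √x := h₂ x
      _ ≤ |C₂| * √x := by gcongr; exact le_abs_self _
      _ ≤ |C₂| * (2 * rpowDivLog 1 1 x) := by gcongr
      _ = _ := by ring
  calc |Chebyshev.theta x - x|
      = |(Chebyshev.psi x - x) - (Chebyshev.psi x - Chebyshev.theta x)| := by congr 1; ring
    _ ≤ |Chebyshev.psi x - x| + |Chebyshev.psi x - Chebyshev.theta x| := abs_sub _ _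
    _ ≤ _ := by linarith

theorem sum_prime_rpowDivLog_eq (β : ℝ) (k : ℕ) {x : ℝ} (hx : 2 ≤ x) :
    ∑ p ∈ (Icc 2 ⌊x⌋₊).filter Nat.Prime, rpowDivLog β k p =
      rpowDivLog β (k + 1) x * Chebyshev.theta x - ∫ t in (2 : ℝ)..x,
        (β * rpowDivLog (β - 1) (k + 1) t - (k + 1 : ℕ) * rpowDivLog (β - 1) (k + 1 + 1) t) *
          Chebyshev.theta t := by
  have hderiv (t : ℝ) (ht : 2 ≤ t) := hasDerivAt_rpowDivLog β (k + 1) ht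
  set c : ℕ → ℝ := fun n => if n.Prime then Real.log n else 0 with hc
  have hθ (t : ℝ) : ∑ n ∈ Icc 0 ⌊t⌋₊, c n = Chebyshev.theta t := by
    rw [Chebyshev.theta_eq_sum_Icc, sum_filter]
  have h := sum_mul_eq_sub_integral_mul₁ (f := rpowDivLog β (k + 1)) c
    (by simp [hc, Nat.not_prime_zero]) (by simp [hc, Nat.not_prime_one]) x
    (fun t ht => (hderiv t ht.1).differentiableAt) (by
      have hcont : ContinuousOn (fun t => β * rpowDivLog (β - 1) (k + 1) t -
          (k + 1 : ℕ) * rpowDivLog (β - 1) (k + 1 + 1) t) (Set.Icc 2 x) :=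
        (((continuousOn_rpowDivLog _ _).const_smul β).sub
          ((continuousOn_rpowDivLog _ _).const_smul ((k + 1 : ℕ) : ℝ))).mono fun t ht => ht.1
      exact (hcont.integrableOn_Icc).congr_fun (fun t ht => (hderiv t ht.1).deriv.symm)
        measurableSet_Icc)
  simp only [hθ] at h
  rw [intervalIntegral.integral_of_le hx]
  have hI : ∫ t in Set.Ioc 2 x, deriv (rpowDivLog β (k + 1)) t * Chebyshev.theta t =
      ∫ t in Set.Ioc 2 x, (β * rpowDivLog (β - 1) (k + 1) t -
        (k + 1 : ℕ) * rpowDivLog (β - 1) (k + 1 + 1) t) * Chebyshev.theta t :=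
    setIntegral_congr_fun measurableSet_Ioc fun t ht => by
      simp only [(hderiv t ht.1.le).deriv]
  rw [← hI, ← h]
  have hset : (Icc 2 ⌊x⌋₊).filter Nat.Prime = (Icc 0 ⌊x⌋₊).filter Nat.Prime := by
    ext p
    simp only [mem_filter, mem_Icc, zero_le, true_and]
    exact ⟨fun h => ⟨h.1.2, h.2⟩, fun h => ⟨⟨h.2.two_le, h.1⟩, h.2⟩⟩
  rw [hset, sum_filter]
  refine sum_congr rfl fun p _ => ?_
  simp only [hc]
  split_ifs with hp
  · have := log_pos_of_two_le (show (2 : ℝ) ≤ p by exact_mod_cast hp.two_le)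
    rw [rpowDivLog, rpowDivLog, pow_succ]
    field_simp
  · simp

theorem exists_abs_sum_prime_rpowDivLog_sub_le {β : ℝ} (hβ : 0 < β) (k : ℕ) :
    ∃ C > 0, ∀ x : ℝ, 2 ≤ x →
      |∑ p ∈ (Icc 2 ⌊x⌋₊).filter Nat.Prime, rpowDivLog β k p -
        rpowDivLog (β + 1) (k + 1) x / (β + 1)| ≤ C * rpowDivLog (β + 1) (k + 2) x := by
  obtain ⟨C₁, hC₁, hR⟩ := exists_abs_theta_sub_le
  obtain ⟨C₂, hC₂, hI⟩ := exists_abs_integral_rpowDivLog_sub_le hβ (k + 1)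
  obtain ⟨C₃, hC₃, hI'⟩ := exists_integral_rpowDivLog_le hβ (k + 2)
  have h2 : 0 < Real.log 2 := log_pos_of_two_le le_rfl
  set M : ℝ := β + (k + 1 : ℕ) * (Real.log 2)⁻¹ with hM
  have hM0 : 0 < M := by positivity
  refine ⟨C₁ + β * C₂ + (k + 1 : ℕ) * C₃ + M * C₁ * C₃, by positivity, fun x hx => ?_⟩
  set g' : ℝ → ℝ := fun t => β * rpowDivLog (β - 1) (k + 1) t -
    (k + 1 : ℕ) * rpowDivLog (β - 1) (k + 1 + 1) t with hg'
  have hg'c : ContinuousOn g' (Set.uIcc 2 x) :=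
    (((continuousOn_rpowDivLog _ _).const_smul β).sub
      ((continuousOn_rpowDivLog _ _).const_smul ((k + 1 : ℕ) : ℝ))).mono fun t ht => by
        rw [Set.uIcc_of_le hx] at ht; exact ht.1
  have hR_int : IntervalIntegrable (fun t => Chebyshev.theta t - t) volume 2 x :=
    (Chebyshev.theta_mono.intervalIntegrable).sub intervalIntegral.intervalIntegrable_id
  have hgR_int : IntervalIntegrable (fun t => g' t * (Chebyshev.theta t - t)) volume 2 x :=
    hR_int.continuousOn_mul hg'c
  have hi₁ := (intervalIntegrable_rpowDivLog β (k + 1) hx).const_mul β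
  have hi₂ := (intervalIntegrable_rpowDivLog β (k + 2) hx).const_mul ((k + 1 : ℕ) : ℝ)
  have hsplit : ∫ t in (2 : ℝ)..x, g' t * Chebyshev.theta t =
      β * (∫ t in (2 : ℝ)..x, rpowDivLog β (k + 1) t) -
        (k + 1 : ℕ) * (∫ t in (2 : ℝ)..x, rpowDivLog β (k + 2) t) +
        ∫ t in (2 : ℝ)..x, g' t * (Chebyshev.theta t - t) := by
    rw [← intervalIntegral.integral_const_mul, ← intervalIntegral.integral_const_mul,
      ← intervalIntegral.integral_sub hi₁ hi₂, ← intervalIntegral.integral_add (hi₁.sub hi₂) hgR_int]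
    refine intervalIntegral.integral_congr fun t ht => ?_
    rw [Set.uIcc_of_le hx] at ht
    have e1 := mul_rpowDivLog (β - 1) (k + 1) ht.1
    have e2 := mul_rpowDivLog (β - 1) (k + 2) ht.1
    rw [sub_add_cancel] at e1 e2
    simp only [hg', ← e1, ← e2]
    ring
  have hgR : |∫ t in (2 : ℝ)..x, g' t * (Chebyshev.theta t - t)| ≤
      M * C₁ * ∫ t in (2 : ℝ)..x, rpowDivLog β (k + 2) t := by
    rw [← intervalIntegral.integral_const_mul, ← Real.norm_eq_abs]
    refine intervalIntegral.norm_integral_le_of_norm_le hx (ae_of_all _ fun t ht => ?_)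
      ((intervalIntegrable_rpowDivLog _ _ hx).const_mul _)
    have ht2 : 2 ≤ t := ht.1.le
    have hp1 := rpowDivLog_pos (β - 1) (k + 1) ht2
    have hp2 := rpowDivLog_pos (β - 1) (k + 1 + 1) ht2
    have hs := mul_le_mul_of_nonneg_left (rpowDivLog_succ_le (β - 1) (k + 1) ht2)
      (Nat.cast_nonneg (α := ℝ) (k + 1))
    have hg'le : |g' t| ≤ M * rpowDivLog (β - 1) (k + 1) t := by
      rw [hM, add_mul]
      have hq1 : 0 < β * rpowDivLog (β - 1) (k + 1) t := by positivity
      have hq2 : 0 ≤ (k + 1 : ℕ) * rpowDivLog (β - 1) (k + 1 + 1) t := by positivity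
      rw [abs_le]
      constructor <;> simp only [hg'] <;> linarith
    rw [norm_mul, Real.norm_eq_abs, Real.norm_eq_abs]
    have e := rpowDivLog_mul_rpowDivLog (β - 1) 1 (k + 1) 1 ht2
    rw [sub_add_cancel] at e
    calc |g' t| * |Chebyshev.theta t - t|
        ≤ M * rpowDivLog (β - 1) (k + 1) t * (C₁ * rpowDivLog 1 1 t) := by
          gcongr
          exact hR t ht2
      _ = M * C₁ * rpowDivLog β (k + 2) t := by rw [← e]; ring
  have hbd : |rpowDivLog β (k + 1) x * (Chebyshev.theta x - x)| ≤
      C₁ * rpowDivLog (β + 1) (k + 2) x := by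
    have hp := rpowDivLog_pos β (k + 1) hx
    rw [abs_mul, abs_of_pos hp, ← rpowDivLog_mul_rpowDivLog β 1 (k + 1) 1 hx]
    calc rpowDivLog β (k + 1) x * |Chebyshev.theta x - x|
        ≤ rpowDivLog β (k + 1) x * (C₁ * rpowDivLog 1 1 x) := by
          gcongr
          exact hR x hx
      _ = _ := by ring
  have hI0 : 0 ≤ ∫ t in (2 : ℝ)..x, rpowDivLog β (k + 2) t :=
    intervalIntegral.integral_nonneg hx fun t ht => (rpowDivLog_pos _ _ ht.1).le
  have hI'x := hI' x hx
  have hIx := hI x hx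
  rw [sum_prime_rpowDivLog_eq β k hx, hsplit]
  set J₁ := ∫ t in (2 : ℝ)..x, rpowDivLog β (k + 1) t
  set J₂ := ∫ t in (2 : ℝ)..x, rpowDivLog β (k + 2) t
  set E := ∫ t in (2 : ℝ)..x, g' t * (Chebyshev.theta t - t)
  have key : rpowDivLog β (k + 1) x * Chebyshev.theta x - (β * J₁ - (k + 1 : ℕ) * J₂ + E) -
      rpowDivLog (β + 1) (k + 1) x / (β + 1) =
      rpowDivLog β (k + 1) x * (Chebyshev.theta x - x) -
        β * (J₁ - rpowDivLog (β + 1) (k + 1) x / (β + 1)) + (k + 1 : ℕ) * J₂ - E := by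
    rw [← mul_rpowDivLog β (k + 1) hx]
    field_simp
    ring
  rw [key]
  have hβI := mul_le_mul_of_nonneg_left hIx hβ.le
  rw [← abs_of_pos hβ, ← abs_mul, abs_of_pos hβ] at hβI
  have hkI := mul_le_mul_of_nonneg_left hI'x (Nat.cast_nonneg (α := ℝ) (k + 1))
  have hkI0 := mul_nonneg (Nat.cast_nonneg (α := ℝ) (k + 1)) hI0
  have hMI := hgR.trans (mul_le_mul_of_nonneg_left hI'x (by positivity : 0 ≤ M * C₁))
  rw [abs_le] at hbd hβI hMI ⊢
  simp only [add_mul]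
  constructor <;> linarith

end PrimeSums

section IteratedPrimeSums

/-- Summing over the primes an asymptotic `c * n ^ β / (log n) ^ k` with a relative error
`O (1 / log n)`. -/
theorem exists_abs_sum_prime_sub_le {β : ℝ} (hβ : 0 < β) (k : ℕ) {f : ℕ → ℝ} {c B : ℝ}
    (hB : 0 ≤ B) (hf : ∀ p : ℕ, 2 ≤ p →
      |f p - c * rpowDivLog β k p| ≤ B * rpowDivLog β (k + 1) p) :
    ∃ C > 0, ∀ x : ℝ, 2 ≤ x →
      |∑ p ∈ (Icc 2 ⌊x⌋₊).filter Nat.Prime, f p -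
        c / (β + 1) * rpowDivLog (β + 1) (k + 1) x| ≤ C * rpowDivLog (β + 1) (k + 2) x := by
  obtain ⟨C₁, hC₁, h₁⟩ := exists_abs_sum_prime_rpowDivLog_sub_le hβ k
  obtain ⟨C₂, hC₂, h₂⟩ := exists_abs_sum_prime_rpowDivLog_sub_le hβ (k + 1)
  have h2 : 0 < Real.log 2 := log_pos_of_two_le le_rfl
  refine ⟨|c| * C₁ + B * (1 + C₂ * (Real.log 2)⁻¹) + 1, by positivity, fun x hx => ?_⟩
  set s := (Icc 2 ⌊x⌋₊).filter Nat.Prime with hs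
  have hx0 := rpowDivLog_pos (β + 1) (k + 2) hx
  have hd : |∑ p ∈ s, (f p - c * rpowDivLog β k p)| ≤
      B * ∑ p ∈ s, rpowDivLog β (k + 1) p := by
    rw [mul_sum]
    refine (abs_sum_le_sum_abs _ _).trans (sum_le_sum fun p hp => hf p ?_)
    exact (mem_Icc.1 (mem_filter.1 hp).1).1
  have hm := mul_le_mul_of_nonneg_left (h₁ x hx) (abs_nonneg c)
  rw [← abs_mul] at hm
  have hsum : ∑ p ∈ s, rpowDivLog β (k + 1) p ≤
      (1 + C₂ * (Real.log 2)⁻¹) * rpowDivLog (β + 1) (k + 2) x := by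
    have h3 := (abs_le.1 (h₂ x hx)).2
    have h4 := mul_le_mul_of_nonneg_left (rpowDivLog_succ_le (β + 1) (k + 2) hx) hC₂.le
    have h5 : rpowDivLog (β + 1) (k + 2) x / (β + 1) ≤ rpowDivLog (β + 1) (k + 2) x :=
      div_le_self hx0.le (by linarith)
    rw [add_mul, one_mul, mul_assoc]
    linarith
  have hd' := hd.trans (mul_le_mul_of_nonneg_left hsum hB)
  have key : ∑ p ∈ s, f p - c / (β + 1) * rpowDivLog (β + 1) (k + 1) x =
      ∑ p ∈ s, (f p - c * rpowDivLog β k p) +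
        c * (∑ p ∈ s, rpowDivLog β k p - rpowDivLog (β + 1) (k + 1) x / (β + 1)) := by
    rw [sum_sub_distrib, ← mul_sum]
    ring
  rw [key]
  refine (abs_add_le _ _).trans ?_
  linarith

/-- The version of `exists_abs_sum_prime_sub_le` for sums over the primes below an integer. -/
theorem exists_abs_sum_range_prime_sub_le {β : ℝ} (hβ : 0 < β) (k : ℕ) {f : ℕ → ℝ} {c B : ℝ}
    (hB : 0 ≤ B) (hf : ∀ p : ℕ, 2 ≤ p →
      |f p - c * rpowDivLog β k p| ≤ B * rpowDivLog β (k + 1) p) :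
    ∃ C > 0, ∀ n : ℕ, 2 ≤ n →
      |∑ p ∈ (range n).filter Nat.Prime, f p -
        c / (β + 1) * rpowDivLog (β + 1) (k + 1) n| ≤ C * rpowDivLog (β + 1) (k + 2) n := by
  obtain ⟨C, hC, h⟩ := exists_abs_sum_prime_sub_le hβ k hB hf
  obtain ⟨C₁, hC₁, h₁⟩ := exists_rpowDivLog_le_add_one β k (k + 2)
  obtain ⟨C₂, hC₂, h₂⟩ := exists_rpowDivLog_le_add_one β (k + 1) (k + 2)
  refine ⟨C + |c| * C₁ + B * C₂, by positivity, fun n hn => ?_⟩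
  have hn2 : (2 : ℝ) ≤ n := by exact_mod_cast hn
  have hsum : ∑ p ∈ (Icc 2 ⌊(n : ℝ)⌋₊).filter Nat.Prime, f p =
      ∑ p ∈ (range n).filter Nat.Prime, f p + if n.Prime then f n else 0 := by
    have hset : (Icc 2 ⌊(n : ℝ)⌋₊).filter Nat.Prime = (range (n + 1)).filter Nat.Prime := by
      ext p
      simp only [Nat.floor_natCast, mem_filter, mem_Icc, mem_range, Nat.lt_succ_iff]
      exact ⟨fun h => ⟨h.1.2, h.2⟩, fun h => ⟨⟨h.2.two_le, h.1⟩, h.2⟩⟩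
    rw [hset, sum_filter, sum_filter, sum_range_succ]
  have hfn : |if n.Prime then f n else 0| ≤
      (|c| * C₁ + B * C₂) * rpowDivLog (β + 1) (k + 2) n := by
    have hp := rpowDivLog_pos (β + 1) (k + 2) hn2
    have hpk := rpowDivLog_pos β k hn2
    split_ifs
    · have e1 : |f n| ≤ |f n - c * rpowDivLog β k n| + |c| * rpowDivLog β k n := by
        rw [← abs_of_pos hpk, ← abs_mul, abs_of_pos hpk]
        simpa using abs_add_le (f n - c * rpowDivLog β k n) (c * rpowDivLog β k n)
      have e2 := hf n hn
      have e3 := mul_le_mul_of_nonneg_left (h₁ n hn2) (abs_nonneg c)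
      have e4 := mul_le_mul_of_nonneg_left (h₂ n hn2) hB
      linarith
    · rw [abs_zero]
      positivity
  have hmain := h n hn2
  rw [hsum] at hmain
  have hadd := abs_sub (∑ p ∈ (range n).filter Nat.Prime, f p +
    (if n.Prime then f n else 0) - c / (β + 1) * rpowDivLog (β + 1) (k + 1) n)
    (if n.Prime then f n else 0)
  rw [add_sub_right_comm, add_sub_cancel_right] at hadd
  rw [add_sub_right_comm] at hmain
  linarith

theorem exists_abs_triple_prime_sum_sub_le {α : ℝ} (hα : 0 < α) :
    ∃ C > 0, ∀ y : ℝ, 2 ≤ y →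
      |∑ p3 ∈ (Icc 2 ⌊y⌋₊).filter Nat.Prime, (p3 : ℝ) ^ (-α) *
          ∑ p2 ∈ (range p3).filter Nat.Prime, ∑ p1 ∈ (range p2).filter Nat.Prime, (p1 : ℝ) ^ α -
        1 / (3 * (α + 1) * (α + 2)) * rpowDivLog 3 3 y| ≤ C * rpowDivLog 3 4 y := by
  obtain ⟨B₁, hB₁, h₁⟩ := exists_abs_sum_range_prime_sub_le hα 0 (f := fun p => (p : ℝ) ^ α)
    (c := 1) le_rfl fun p _ => by simp [rpowDivLog]
  obtain ⟨B₂, hB₂, h₂⟩ := exists_abs_sum_range_prime_sub_le (by linarith) (0 + 1) hB₁.le h₁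
  obtain ⟨B₃, hB₃, h₃⟩ := exists_abs_sum_prime_sub_le two_pos 2 (f := fun p => (p : ℝ) ^ (-α) *
      ∑ p2 ∈ (range p).filter Nat.Prime, ∑ p1 ∈ (range p2).filter Nat.Prime, (p1 : ℝ) ^ α)
    (c := 1 / (α + 1) / (α + 1 + 1)) hB₂.le fun p hp => by
      have hp2 : (2 : ℝ) ≤ p := by exact_mod_cast hp
      have hpos : (0 : ℝ) < (p : ℝ) ^ (-α) := Real.rpow_pos_of_pos (by linarith) _
      have e (m : ℕ) : rpowDivLog 2 m p = (p : ℝ) ^ (-α) * rpowDivLog (α + 1 + 1) m p := by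
        rw [rpowDivLog, rpowDivLog, ← mul_div_assoc, ← Real.rpow_add (by linarith)]
        congr 2
        ring
      rw [e, e, mul_left_comm _ ((p : ℝ) ^ (-α)), mul_left_comm _ ((p : ℝ) ^ (-α)), ← mul_sub,
        abs_mul, abs_of_pos hpos]
      exact mul_le_mul_of_nonneg_left (h₂ p hp) hpos.le
  refine ⟨B₃, hB₃, fun y hy => ?_⟩
  convert h₃ y hy using 3
  · congr 1
    · rw [div_div, div_div]
      congr 1
      ring
    · norm_num
  · norm_num

theorem rpowDivLog_three_rpow_third {x : ℝ} (hx : 0 < x) (m : ℕ) :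
    rpowDivLog 3 m (x ^ ((1 : ℝ) / 3)) = 3 ^ m * (x / Real.log x ^ m) := by
  rw [rpowDivLog, Real.log_rpow hx, ← Real.rpow_mul hx.le, mul_pow]
  norm_num
  field_simp
  rw [← mul_pow]
  norm_num

end IteratedPrimeSums

/-- For `α > 0`,
`Σ_{p₃ ≤ x^{1/3}} p₃^{-α} Σ_{p₂ < p₃} Σ_{p₁ < p₂} p₁^α
  = (9/((α+1)(α+2)))·x/log³x + O(x/log⁴x)`, the sums ranging over primes. -/
theorem I3_asymptotic (α : ℝ) (hα : 0 < α) :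
    (fun x : ℝ =>
        (∑ p3 ∈ (Finset.Icc 2 ⌊x ^ ((1:ℝ) / 3)⌋₊).filter Nat.Prime,
            (p3 : ℝ) ^ (-α) *
              ∑ p2 ∈ (Finset.range p3).filter Nat.Prime,
                ∑ p1 ∈ (Finset.range p2).filter Nat.Prime, (p1 : ℝ) ^ α)
        - (9 / ((α + 1) * (α + 2))) * (x / Real.log x ^ 3))
      =O[atTop] (fun x : ℝ => x / Real.log x ^ 4) := by
  obtain ⟨C, hC, h⟩ := exists_abs_triple_prime_sum_sub_le hα
  refine Asymptotics.IsBigO.of_bound (C * 3 ^ 4) ?_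
  filter_upwards [eventually_ge_atTop 8] with x hx
  have hx0 : 0 < x := by linarith
  have hy : 2 ≤ x ^ ((1 : ℝ) / 3) := by
    have h8 : (8 : ℝ) ^ ((1 : ℝ) / 3) = 2 := by
      rw [show (8 : ℝ) = 2 ^ (3 : ℝ) by norm_num, ← Real.rpow_mul two_pos.le]
      norm_num
    rw [← h8]
    gcongr
  have h1 := h _ hy
  rw [rpowDivLog_three_rpow_third hx0, rpowDivLog_three_rpow_third hx0] at h1
  have hL := log_pos_of_two_le (show 2 ≤ x by linarith)
  rw [Real.norm_eq_abs, Real.norm_of_nonneg (by positivity)]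
  convert h1 using 1
  · congr 2
    field_simp
    ring
  · ring
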